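/- arXiv:1309.3692 — 2 statements merged into one kernel-verified Lean document; each statement's English description precedes it below -/
import Mathlib

section
/- Key inequality L4 for negatively correlated channels: assume p11 ≤ p01, 0 ≤ β < 1, and β·(ℛ̲ + ℛ̄) ≤ ℛ̲, and set γ := ℛ̄/(1−β). Then for every t ∈ {1,…,T} and every belief vector ω ∈ [0,1]^N with p01 ≥ ω₁ ≥ ω₂ ≥ … ≥ ω_N ≥ p11, it holds that γ + W_t(ω_N, ω₁, …, ω_{N−1}) ≥ W_t(ω₁, …, ω_N). -/
open Finset

noncomputable section

/-- Belief update map `τ(ω) = ω·p11 + (1-ω)·p01`. -/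
def tau (p01 p11 ω : ℝ) : ℝ := ω * p11 + (1 - ω) * p01

/-- Expected one-step reward `R_m(ω; S)` with access cap `m`:
the expectation of `min(#available, m)` when each channel `i ∈ S` is
independently available with probability `ω i`. -/
def expReward {ι : Type*} [DecidableEq ι] (m : ℕ) (S : Finset ι) (ω : ι → ℝ) : ℝ :=
  ∑ A ∈ S.powerset,
    (∏ i ∈ A, ω i) * (∏ i ∈ S \ A, (1 - ω i)) * ((min A.card m : ℕ) : ℝ)

/-- The set of reward increments `R_m(1,x) − R_m(0,x)` over `x ∈ [lo,hi]^{k'}`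
(on `k' + 1` channels). -/
def RdiffSet (lo hi : ℝ) (m k' : ℕ) : Set ℝ :=
  { r : ℝ | ∃ x : Fin k' → ℝ, (∀ i, x i ∈ Set.Icc lo hi) ∧
      r = expReward m Finset.univ (Fin.cons 1 x) -
          expReward m Finset.univ (Fin.cons 0 x) }

/-- `ℛ̄`: maximal reward increment. -/
def Rbar (lo hi : ℝ) (m k' : ℕ) : ℝ := sSup (RdiffSet lo hi m k')

/-- `ℛ̲`: minimal reward increment. -/
def Rlow (lo hi : ℝ) (m k' : ℕ) : ℝ := sInf (RdiffSet lo hi m k')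

/-- The first `k` channels out of `N` (the myopically sensed channels for a
descending-ordered belief vector). -/
def senseSet (N k : ℕ) : Finset (Fin N) := Finset.univ.filter (fun i => (i : ℕ) < k)

/-- Positively correlated case successor belief vector: `c` copies of `p11`,
then `τ(ω_{k+1}), …, τ(ω_N)`, then `k - c` copies of `p01`. -/
def nextPos (p01 p11 : ℝ) {N : ℕ} (k : ℕ) (ω : Fin N → ℝ) (c : ℕ) : Fin N → ℝ :=
  fun i =>
    if h1 : (i : ℕ) < c then p11
    else if h2 : (i : ℕ) < c + (N - k) then
      tau p01 p11 (ω ⟨k + ((i : ℕ) - c), by have := i.isLt; omega⟩)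
    else p01

/-- Negatively correlated case successor belief vector: `k - c` copies of `p01`,
then `τ(ω_N), τ(ω_{N-1}), …, τ(ω_{k+1})` (reversed), then `c` copies of `p11`. -/
def nextNeg (p01 p11 : ℝ) {N : ℕ} (k : ℕ) (ω : Fin N → ℝ) (c : ℕ) : Fin N → ℝ :=
  fun i =>
    if h1 : (i : ℕ) < k - c then p01
    else if h2 : (i : ℕ) < (k - c) + (N - k) then
      tau p01 p11 (ω ⟨N - 1 - ((i : ℕ) - (k - c)), by have := i.isLt; omega⟩)
    else p11

/-- Myopic value functions for the positively correlated case, indexed by the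
number `s` of remaining steps (so `W_t = Wpos (T - t)`). -/
def Wpos (p01 p11 β : ℝ) (N k m : ℕ) : ℕ → (Fin N → ℝ) → ℝ
  | 0, ω => expReward m (senseSet N k) ω
  | s + 1, ω =>
    expReward m (senseSet N k) ω +
      β * ∑ A ∈ (senseSet N k).powerset,
        (∏ i ∈ A, ω i) * (∏ i ∈ senseSet N k \ A, (1 - ω i)) *
          Wpos p01 p11 β N k m s (nextPos p01 p11 k ω A.card)

/-- Myopic value functions for the negatively correlated case, indexed by the
number `s` of remaining steps (so `W_t = Wneg (T - t)`). -/
def Wneg (p01 p11 β : ℝ) (N k m : ℕ) : ℕ → (Fin N → ℝ) → ℝ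
  | 0, ω => expReward m (senseSet N k) ω
  | s + 1, ω =>
    expReward m (senseSet N k) ω +
      β * ∑ A ∈ (senseSet N k).powerset,
        (∏ i ∈ A, ω i) * (∏ i ∈ senseSet N k \ A, (1 - ω i)) *
          Wneg p01 p11 β N k m s (nextNeg p01 p11 k ω A.card)

/-- Optimal value functions, indexed by the number `s` of remaining steps
(so `V_t = Vopt (T - t)`). -/
def Vopt (p01 p11 β : ℝ) (N k m : ℕ) : ℕ → (Fin N → ℝ) → ℝ
  | 0, ω => sSup { r : ℝ | ∃ π : Finset (Fin N), π.card = k ∧ r = expReward m π ω }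
  | s + 1, ω =>
    sSup { r : ℝ | ∃ π : Finset (Fin N), π.card = k ∧
      r = expReward m π ω +
        β * ∑ B ∈ π.powerset,
          (∏ i ∈ B, ω i) * (∏ i ∈ π \ B, (1 - ω i)) *
            Vopt p01 p11 β N k m s
              (fun j => if j ∈ B then p11 else if j ∈ π then p01 else tau p01 p11 (ω j)) }

/-- The cyclic right shift `(ω_N, ω_1, …, ω_{N-1})`. -/
def cycR {N : ℕ} (ω : Fin N → ℝ) : Fin N → ℝ :=
  fun i =>
    if h : (i : ℕ) = 0 then ω ⟨N - 1, by have := i.isLt; omega⟩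
    else ω ⟨(i : ℕ) - 1, by have := i.isLt; omega⟩

/-- The cyclic left shift `(ω_2, ω_3, …, ω_N, ω_1)`. -/
def cycL {N : ℕ} (ω : Fin N → ℝ) : Fin N → ℝ :=
  fun i =>
    if h : (i : ℕ) + 1 < N then ω ⟨(i : ℕ) + 1, h⟩
    else ω ⟨0, by have := i.isLt; omega⟩

/-- The vector `(ω_1, …, ω_{j-1}, x, y, ω_{j+2}, …, ω_N)` (0-indexed: `x` at
position `j`, `y` at position `j+1`). -/
def swapAt {N : ℕ} (ω : Fin N → ℝ) (j : ℕ) (x y : ℝ) : Fin N → ℝ :=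
  fun i => if (i : ℕ) = j then x else if (i : ℕ) = j + 1 then y else ω i

end

/-- Expectation of `f c`, where `c` is the number of successes among independent Bernoulli
trials whose success probabilities are listed in `l`. -/
noncomputable def bernExp : List ℝ → (ℕ → ℝ) → ℝ
  | [], f => f 0
  | x :: l, f => x * bernExp l (fun c => f (c + 1)) + (1 - x) * bernExp l f

/-- The successor belief list after `c` successes, where `b` lists the unsensed beliefs. -/
noncomputable def succList (p01 p11 : ℝ) (k : ℕ) (b : List ℝ) (c : ℕ) : List ℝ :=
  List.replicate (k - c) p01 ++ ((b.map (tau p01 p11)).reverse ++ List.replicate c p11)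

/-- List version of the myopic value function, indexed by the number of rewards collected. -/
noncomputable def listValue (p01 p11 β : ℝ) (k m : ℕ) : ℕ → List ℝ → ℝ
  | 0, _ => 0
  | s + 1, l => bernExp (l.take k) (fun c => ((min c m : ℕ) : ℝ) +
      β * listValue p01 p11 β k m s (succList p01 p11 k (l.drop k) c))

theorem bernExp_perm {l l' : List ℝ} (h : l.Perm l') (f : ℕ → ℝ) :
    bernExp l f = bernExp l' f := by
  induction h generalizing f with
  | nil => rfl
  | cons x _ ih => simp only [bernExp, ih]
  | swap x y l => simp only [bernExp]; ring
  | trans _ _ ih₁ ih₂ => rw [ih₁, ih₂]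

theorem bernExp_linear (l : List ℝ) (a b : ℝ) (f g : ℕ → ℝ) :
    bernExp l (fun c => a * f c + b * g c) = a * bernExp l f + b * bernExp l g := by
  induction l generalizing f g with
  | nil => rfl
  | cons x l ih =>
    simp only [bernExp, ih f g, ih (fun c => f (c + 1)) (fun c => g (c + 1))]; ring

theorem bernExp_sub (l : List ℝ) (f g : ℕ → ℝ) :
    bernExp l (fun c => f c - g c) = bernExp l f - bernExp l g := by
  have h := bernExp_linear l 1 (-1) f g
  simpa [sub_eq_add_neg] using h

theorem bernExp_const (l : List ℝ) (a : ℝ) : bernExp l (fun _ => a) = a := by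
  induction l with
  | nil => rfl
  | cons x l ih => simp only [bernExp, ih]; ring

theorem bernExp_mono {l : List ℝ} (hl : ∀ x ∈ l, x ∈ Set.Icc (0 : ℝ) 1) {f g : ℕ → ℝ}
    (h : ∀ c ≤ l.length, f c ≤ g c) : bernExp l f ≤ bernExp l g := by
  induction l generalizing f g with
  | nil => exact h 0 le_rfl
  | cons x l ih =>
    have hx := hl x (by simp)
    have hl' : ∀ y ∈ l, y ∈ Set.Icc (0 : ℝ) 1 := fun y hy => hl y (by simp [hy])
    have h₁ : bernExp l (fun c => f (c + 1)) ≤ bernExp l (fun c => g (c + 1)) :=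
      ih hl' fun c hc => h (c + 1) (by simpa using hc)
    have h₂ : bernExp l f ≤ bernExp l g :=
      ih hl' fun c hc => h c (by simp only [List.length_cons]; omega)
    exact add_le_add (mul_le_mul_of_nonneg_left h₁ hx.1)
      (mul_le_mul_of_nonneg_left h₂ (by linarith [hx.2]))

theorem bernExp_congr {l : List ℝ} {f g : ℕ → ℝ}
    (h : ∀ c ≤ l.length, f c = g c) : bernExp l f = bernExp l g := by
  induction l generalizing f g with
  | nil => exact h 0 le_rfl
  | cons x l ih =>
    simp only [bernExp]
    rw [ih (f := f) (g := g) fun c hc => h c (by simp only [List.length_cons]; omega),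
      ih (f := fun c => f (c + 1)) (g := fun c => g (c + 1))
        fun c hc => h (c + 1) (by simpa using hc)]

theorem bernExp_append_cons (a b : List ℝ) (x : ℝ) (f : ℕ → ℝ) :
    bernExp (a ++ x :: b) f =
      x * bernExp (a ++ b) (fun c => f (c + 1)) + (1 - x) * bernExp (a ++ b) f := by
  rw [bernExp_perm List.perm_middle]; rfl

theorem sum_powerset_toFinset_eq_bernExp {ι : Type*} [DecidableEq ι] (ω : ι → ℝ) (l : List ι)
    (hl : l.Nodup) (f : ℕ → ℝ) :
    ∑ A ∈ l.toFinset.powerset,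
      (∏ i ∈ A, ω i) * (∏ i ∈ l.toFinset \ A, (1 - ω i)) * f A.card =
      bernExp (l.map ω) f := by
  induction l generalizing f with
  | nil => simp [bernExp]
  | cons x l ih =>
    obtain ⟨hx, hl⟩ := List.nodup_cons.1 hl
    have hx' : x ∉ l.toFinset := by simpa using hx
    rw [List.toFinset_cons, Finset.sum_powerset_insert hx', List.map_cons, bernExp, ← ih hl,
      ← ih hl, Finset.mul_sum, Finset.mul_sum, add_comm]
    congr 1
    · refine Finset.sum_congr rfl fun A hA => ?_
      have hxA : x ∉ A := fun h => hx' (Finset.mem_powerset.1 hA h)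
      rw [Finset.prod_insert hxA, Finset.card_insert_of_notMem hxA,
        Finset.insert_sdiff_insert, Finset.sdiff_insert_of_notMem hx']
      ring
    · refine Finset.sum_congr rfl fun A hA => ?_
      have hxA : x ∉ A := fun h => hx' (Finset.mem_powerset.1 hA h)
      rw [Finset.insert_sdiff_of_notMem _ hxA, Finset.prod_insert (by simp [hx])]
      ring

theorem sum_senseSet_eq_bernExp {N : ℕ} (k : ℕ) (ω : Fin N → ℝ) (f : ℕ → ℝ) :
    ∑ A ∈ (senseSet N k).powerset,
      (∏ i ∈ A, ω i) * (∏ i ∈ senseSet N k \ A, (1 - ω i)) * f A.card =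
      bernExp ((List.ofFn ω).take k) f := by
  have hS : senseSet N k = ((List.finRange N).take k).toFinset := by
    ext i
    simp only [senseSet, Finset.mem_filter, Finset.mem_univ, true_and, List.mem_toFinset,
      List.mem_take_iff_getElem]
    constructor
    · exact fun h => ⟨i, by simp [h], by simp⟩
    · rintro ⟨j, hj, rfl⟩
      simp only [List.length_finRange, lt_inf_iff] at hj
      simpa using hj.1
  rw [hS, sum_powerset_toFinset_eq_bernExp _ _ ((List.nodup_finRange N).sublist
    (List.take_sublist _ _)), List.map_take, ← List.ofFn_eq_map]

theorem expReward_cons_eq_bernExp (m n : ℕ) (y : ℝ) (x : Fin n → ℝ) :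
    expReward m Finset.univ (Fin.cons y x : Fin (n + 1) → ℝ) =
      bernExp (y :: List.ofFn x) (fun c => ((min c m : ℕ) : ℝ)) := by
  have h := sum_powerset_toFinset_eq_bernExp (Fin.cons y x : Fin (n + 1) → ℝ)
    (List.finRange (n + 1)) (List.nodup_finRange _) (fun c => ((min c m : ℕ) : ℝ))
  rw [List.toFinset_finRange, ← List.ofFn_eq_map, List.ofFn_cons] at h
  exact h

theorem ofFn_nextNeg (p01 p11 : ℝ) {N k c : ℕ} (hk : k ≤ N) (hc : c ≤ k) (ω : Fin N → ℝ) :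
    List.ofFn (nextNeg p01 p11 k ω c) = succList p01 p11 k ((List.ofFn ω).drop k) c := by
  apply List.ext_getElem
  · simp [succList]; omega
  · intro i h₁ h₂
    simp only [List.length_ofFn] at h₁
    simp only [succList, List.getElem_ofFn, nextNeg, List.getElem_append, List.length_replicate,
      List.length_reverse, List.length_map, List.length_drop, List.length_ofFn,
      List.getElem_replicate, List.getElem_reverse, List.getElem_map, List.getElem_drop]
    split_ifs with h₃ h₄ h₅ h₆
    · rfl
    · congr 3; omega
    · omega
    · omega
    · rfl

theorem Wneg_eq_listValue (p01 p11 β : ℝ) {N k : ℕ} (hk : k ≤ N) (m s : ℕ) (ω : Fin N → ℝ) :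
    Wneg p01 p11 β N k m s ω = listValue p01 p11 β k m (s + 1) (List.ofFn ω) := by
  induction s generalizing ω with
  | zero =>
    have h := sum_senseSet_eq_bernExp k ω (fun c => ((min c m : ℕ) : ℝ))
    simpa [Wneg, listValue, expReward] using h
  | succ s ih =>
    have h := sum_senseSet_eq_bernExp k ω (fun c => ((min c m : ℕ) : ℝ))
    rw [Wneg, listValue, expReward, h,
      sum_senseSet_eq_bernExp k ω (fun c => Wneg p01 p11 β N k m s (nextNeg p01 p11 k ω c))]
    have h' := bernExp_linear ((List.ofFn ω).take k) 1 β (fun c => ((min c m : ℕ) : ℝ))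
      (fun c => Wneg p01 p11 β N k m s (nextNeg p01 p11 k ω c))
    rw [one_mul] at h'
    rw [← h']
    refine bernExp_congr fun c hc => ?_
    have hc' : c ≤ k := hc.trans (List.length_take_le _ _)
    rw [ih, ofFn_nextNeg _ _ hk hc', one_mul]

theorem ofFn_cycR {n : ℕ} (ω : Fin (n + 1) → ℝ) :
    List.ofFn (cycR ω) = ω (Fin.last n) :: List.ofFn (fun i : Fin n => ω i.castSucc) := by
  rw [List.ofFn_succ]
  congr 1

theorem listValue_affine (p01 p11 β : ℝ) (k m s : ℕ) (a b : List ℝ) (x : ℝ) :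
    listValue p01 p11 β k m s (a ++ x :: b) =
      x * listValue p01 p11 β k m s (a ++ 1 :: b) +
        (1 - x) * listValue p01 p11 β k m s (a ++ 0 :: b) := by
  induction s generalizing a b x with
  | zero => simp [listValue]
  | succ s ih =>
    rcases lt_or_ge a.length k with h | h
    · obtain ⟨d, rfl⟩ : ∃ d, k = a.length + (d + 1) := ⟨k - a.length - 1, by omega⟩
      simp only [listValue, List.take_length_add_append, List.drop_length_add_append,
        List.take_succ_cons, List.drop_succ_cons, bernExp_append_cons]
      ring
    · simp only [listValue, List.take_append_of_le_length h, List.drop_append_of_le_length h]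
      rw [← bernExp_linear]
      congr 1
      ext c
      have key : ∀ y : ℝ, listValue p01 p11 β k m s (succList p01 p11 k (a.drop k ++ y :: b) c) =
          tau p01 p11 y * listValue p01 p11 β k m s
            ((List.replicate (k - c) p01 ++ (b.map (tau p01 p11)).reverse) ++ 1 ::
              (((a.drop k).map (tau p01 p11)).reverse ++ List.replicate c p11)) +
          (1 - tau p01 p11 y) * listValue p01 p11 β k m s
            ((List.replicate (k - c) p01 ++ (b.map (tau p01 p11)).reverse) ++ 0 ::
              (((a.drop k).map (tau p01 p11)).reverse ++ List.replicate c p11)) := by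
        intro y
        rw [← ih]
        simp [succList]
      rw [key x, key 1, key 0]
      simp only [tau]
      ring

/-- Swapping an adjacent pair `(0, 1)` into `(1, 0)` does not decrease `V`, when the other
entries lie in `[lo, hi]`. -/
def SwapMono (lo hi : ℝ) (N : ℕ) (V : List ℝ → ℝ) : Prop :=
  ∀ a b : List ℝ, (∀ x ∈ a ++ b, x ∈ Set.Icc lo hi) → (a ++ b).length + 2 = N →
    V (a ++ 0 :: 1 :: b) ≤ V (a ++ 1 :: 0 :: b)

/-- Moving the first entry to the end changes `V` by at most `γ`. -/
def CycBound (lo hi : ℝ) (N : ℕ) (γ : ℝ) (V : List ℝ → ℝ) : Prop :=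
  ∀ u : List ℝ, (∀ x ∈ u, x ∈ Set.Icc lo hi) → u.length + 1 = N →
    ∀ x ∈ Set.Icc (0 : ℝ) 1, |V (x :: u) - V (u ++ [x])| ≤ γ

/-- `V` is affine in each entry. -/
def EntryAffine (V : List ℝ → ℝ) : Prop :=
  ∀ (a b : List ℝ) (x : ℝ), V (a ++ x :: b) = x * V (a ++ 1 :: b) + (1 - x) * V (a ++ 0 :: b)

section Insertion

variable {lo hi γ : ℝ} {N : ℕ} {V : List ℝ → ℝ}

theorem SwapMono.swap_le (hS : SwapMono lo hi N V) (hA : EntryAffine V) {a b : List ℝ} {x y : ℝ}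
    (hab : ∀ z ∈ a ++ b, z ∈ Set.Icc lo hi) (hN : (a ++ b).length + 2 = N) (hxy : y ≤ x) :
    V (a ++ y :: x :: b) ≤ V (a ++ x :: y :: b) := by
  have key : ∀ u v : ℝ, V (a ++ u :: v :: b) =
      u * (v * V (a ++ 1 :: 1 :: b) + (1 - v) * V (a ++ 1 :: 0 :: b)) +
      (1 - u) * (v * V (a ++ 0 :: 1 :: b) + (1 - v) * V (a ++ 0 :: 0 :: b)) := by
    intro u v
    have h1 := hA (a ++ [1]) b v
    have h0 := hA (a ++ [0]) b v
    simp only [List.append_assoc, List.cons_append, List.nil_append] at h1 h0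
    rw [hA, h1, h0]
  rw [key x y, key y x]
  nlinarith [mul_nonneg (sub_nonneg.2 hxy) (sub_nonneg.2 (hS a b hab hN))]

theorem SwapMono.move_le_of_ge (hS : SwapMono lo hi N V) (hA : EntryAffine V) (a b c : List ℝ)
    {x : ℝ} (hb : ∀ y ∈ b, y ≤ x)
    (habc : ∀ z ∈ a ++ (b ++ c), z ∈ Set.Icc lo hi) (hN : (a ++ (b ++ c)).length + 1 = N) :
    V (a ++ (b ++ x :: c)) ≤ V (a ++ x :: (b ++ c)) := by
  induction b generalizing a with
  | nil => simp
  | cons y b ih =>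
    have h₁ := ih (a ++ [y]) (fun z hz => hb z (by simp [hz])) (by simpa using habc)
      (by simpa using hN)
    have h₂ := hS.swap_le hA (a := a) (b := b ++ c) (x := x) (y := y)
      (fun z hz => habc z (by simp at hz ⊢; tauto)) (by simp at hN ⊢; omega) (hb y (by simp))
    simp only [List.append_assoc, List.cons_append, List.nil_append] at h₁ ⊢
    exact h₁.trans h₂

theorem SwapMono.move_le_of_le (hS : SwapMono lo hi N V) (hA : EntryAffine V) (a b c : List ℝ)
    {x : ℝ} (hb : ∀ y ∈ b, x ≤ y)
    (habc : ∀ z ∈ a ++ (b ++ c), z ∈ Set.Icc lo hi) (hN : (a ++ (b ++ c)).length + 1 = N) :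
    V (a ++ x :: (b ++ c)) ≤ V (a ++ (b ++ x :: c)) := by
  induction b generalizing a with
  | nil => simp
  | cons y b ih =>
    have h₁ := ih (a ++ [y]) (fun z hz => hb z (by simp [hz])) (by simpa using habc)
      (by simpa using hN)
    have h₂ := hS.swap_le hA (a := a) (b := b ++ c) (x := y) (y := x)
      (fun z hz => habc z (by simp at hz ⊢; tauto)) (by simp at hN ⊢; omega) (hb y (by simp))
    simp only [List.append_assoc, List.cons_append, List.nil_append] at h₁ ⊢
    exact h₂.trans h₁

theorem SwapMono.abs_sub_insert_hi_le (hS : SwapMono lo hi N V) (hA : EntryAffine V)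
    (hC : CycBound lo hi N γ V) (h01 : hi ∈ Set.Icc (0 : ℝ) 1)
    {a b a' b' : List ℝ} (hab : ∀ z ∈ a ++ b, z ∈ Set.Icc lo hi)
    (hN : (a ++ b).length + 1 = N) (heq : a' ++ b' = a ++ b) :
    |V (a ++ hi :: b) - V (a' ++ hi :: b')| ≤ γ := by
  have key : ∀ a₁ b₁ : List ℝ, a₁ ++ b₁ = a ++ b → V (a₁ ++ hi :: b₁) ≤ V (hi :: (a ++ b)) ∧
      V ((a ++ b) ++ [hi]) ≤ V (a₁ ++ hi :: b₁) := by
    intro a₁ b₁ h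
    rw [← h] at hab hN ⊢
    have h₁ := hS.move_le_of_ge hA [] a₁ b₁ (fun y hy => (hab y (by simp [hy])).2) hab hN
    have h₂ := hS.move_le_of_ge hA a₁ b₁ [] (fun y hy => (hab y (by simp [hy])).2)
      (by simpa using hab) (by simpa using hN)
    simp only [List.nil_append, List.append_nil] at h₁ h₂
    exact ⟨h₁, by simpa using h₂⟩
  have h := abs_le.1 (hC _ hab hN hi h01)
  obtain ⟨h₁, h₂⟩ := key a b rfl
  obtain ⟨h₃, h₄⟩ := key a' b' heq
  exact abs_le.2 ⟨by linarith [h.2], by linarith [h.2]⟩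

theorem SwapMono.abs_sub_insert_lo_le (hS : SwapMono lo hi N V) (hA : EntryAffine V)
    (hC : CycBound lo hi N γ V) (h01 : lo ∈ Set.Icc (0 : ℝ) 1)
    {a b a' b' : List ℝ} (hab : ∀ z ∈ a ++ b, z ∈ Set.Icc lo hi)
    (hN : (a ++ b).length + 1 = N) (heq : a' ++ b' = a ++ b) :
    |V (a ++ lo :: b) - V (a' ++ lo :: b')| ≤ γ := by
  have key : ∀ a₁ b₁ : List ℝ, a₁ ++ b₁ = a ++ b → V (lo :: (a ++ b)) ≤ V (a₁ ++ lo :: b₁) ∧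
      V (a₁ ++ lo :: b₁) ≤ V ((a ++ b) ++ [lo]) := by
    intro a₁ b₁ h
    rw [← h] at hab hN ⊢
    have h₁ := hS.move_le_of_le hA [] a₁ b₁ (fun y hy => (hab y (by simp [hy])).1) hab hN
    have h₂ := hS.move_le_of_le hA a₁ b₁ [] (fun y hy => (hab y (by simp [hy])).1)
      (by simpa using hab) (by simpa using hN)
    simp only [List.nil_append, List.append_nil] at h₁ h₂
    exact ⟨h₁, by simpa using h₂⟩
  have h := abs_le.1 (hC _ hab hN lo h01)
  obtain ⟨h₁, h₂⟩ := key a b rfl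
  obtain ⟨h₃, h₄⟩ := key a' b' heq
  exact abs_le.2 ⟨by linarith [h.1], by linarith [h.1]⟩

end Insertion

theorem tau_mem_Icc {p01 p11 x : ℝ} (hp : p11 ≤ p01) (hx : x ∈ Set.Icc (0 : ℝ) 1) :
    tau p01 p11 x ∈ Set.Icc p11 p01 := by
  unfold tau
  constructor <;> nlinarith [mul_nonneg hx.1 (sub_nonneg.2 hp),
    mul_nonneg (sub_nonneg.2 hx.2) (sub_nonneg.2 hp)]

theorem abs_convex_combination_le {x a b γ : ℝ} (hx : x ∈ Set.Icc (0 : ℝ) 1) (ha : |a| ≤ γ)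
    (hb : |b| ≤ γ) : |x * a + (1 - x) * b| ≤ γ := by
  rw [abs_le] at *
  constructor <;> nlinarith [hx.1, hx.2, mul_le_mul_of_nonneg_left ha.1 hx.1,
    mul_le_mul_of_nonneg_left ha.2 hx.1, mul_le_mul_of_nonneg_left hb.1 (sub_nonneg.2 hx.2),
    mul_le_mul_of_nonneg_left hb.2 (sub_nonneg.2 hx.2)]

/-- Increment of the capped reward when one more channel is available. -/
def rewardIncr (m c : ℕ) : ℝ := ((min (c + 1) m : ℕ) : ℝ) - ((min c m : ℕ) : ℝ)

theorem rewardIncr_mem_Icc (m c : ℕ) : rewardIncr m c ∈ Set.Icc (0 : ℝ) 1 := by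
  have h₁ : min c m ≤ min (c + 1) m := by omega
  have h₂ : min (c + 1) m ≤ min c m + 1 := by omega
  have h₁' : ((min c m : ℕ) : ℝ) ≤ ((min (c + 1) m : ℕ) : ℝ) := by exact_mod_cast h₁
  have h₂' : ((min (c + 1) m : ℕ) : ℝ) ≤ ((min c m : ℕ) : ℝ) + 1 := by exact_mod_cast h₂
  unfold rewardIncr
  constructor <;> linarith

theorem bernExp_rewardIncr_mem_Icc (m : ℕ) {l : List ℝ} (hl : ∀ x ∈ l, x ∈ Set.Icc (0 : ℝ) 1) :
    bernExp l (rewardIncr m) ∈ Set.Icc (0 : ℝ) 1 := by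
  have h₀ := bernExp_mono hl (f := fun _ => 0) (g := rewardIncr m)
    fun c _ => (rewardIncr_mem_Icc m c).1
  have h₁ := bernExp_mono hl (f := rewardIncr m) (g := fun _ => 1)
    fun c _ => (rewardIncr_mem_Icc m c).2
  rw [bernExp_const] at h₀ h₁
  exact ⟨h₀, h₁⟩

theorem expReward_cons_one_sub_cons_zero (m n : ℕ) (x : Fin n → ℝ) :
    expReward m Finset.univ (Fin.cons 1 x : Fin (n + 1) → ℝ) -
      expReward m Finset.univ (Fin.cons 0 x : Fin (n + 1) → ℝ) =
      bernExp (List.ofFn x) (rewardIncr m) := by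
  rw [expReward_cons_eq_bernExp, expReward_cons_eq_bernExp]
  simp only [bernExp]
  unfold rewardIncr
  rw [bernExp_sub]
  ring

theorem RdiffSet_subset_Icc {lo hi : ℝ} (hlo : 0 ≤ lo) (hhi : hi ≤ 1) (m n : ℕ) :
    RdiffSet lo hi m n ⊆ Set.Icc 0 1 := by
  rintro _ ⟨x, hx, rfl⟩
  rw [expReward_cons_one_sub_cons_zero]
  refine bernExp_rewardIncr_mem_Icc m fun y hy => ?_
  obtain ⟨i, rfl⟩ := (List.mem_ofFn' _ _).1 hy
  exact ⟨hlo.trans (hx i).1, (hx i).2.trans hhi⟩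

theorem bernExp_rewardIncr_mem_Icc_Rlow_Rbar {lo hi : ℝ} (hlo : 0 ≤ lo) (hhi : hi ≤ 1) (m : ℕ)
    {l : List ℝ} (hl : ∀ x ∈ l, x ∈ Set.Icc lo hi) :
    bernExp l (rewardIncr m) ∈ Set.Icc (Rlow lo hi m l.length) (Rbar lo hi m l.length) := by
  have hmem : bernExp l (rewardIncr m) ∈ RdiffSet lo hi m l.length :=
    ⟨l.get, fun i => hl _ (l.get_mem i), by
      rw [expReward_cons_one_sub_cons_zero, List.ofFn_get]⟩
  have hsub := RdiffSet_subset_Icc hlo hhi m l.length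
  exact ⟨csInf_le (bddBelow_Icc.mono hsub) hmem, le_csSup (bddAbove_Icc.mono hsub) hmem⟩

section SuccList

variable {p01 p11 γ : ℝ} {N n c : ℕ} {V : List ℝ → ℝ} {v : List ℝ}

theorem succList_cons_one (hc : c ≤ n) :
    succList p01 p11 (n + 1) (1 :: v) c = p01 :: (List.replicate (n - c) p01 ++
      ((v.map (tau p01 p11)).reverse ++ p11 :: List.replicate c p11)) := by
  simp [succList, tau, Nat.sub_add_comm hc, List.replicate_succ]

theorem succList_cons_one_succ :
    succList p01 p11 (n + 1) (1 :: v) (c + 1) = List.replicate (n - c) p01 ++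
      ((v.map (tau p01 p11)).reverse ++ p11 :: p11 :: List.replicate c p11) := by
  simp [succList, tau, List.replicate_succ]

theorem succList_cons_zero (hc : c ≤ n) :
    succList p01 p11 (n + 1) (0 :: v) c = p01 :: (List.replicate (n - c) p01 ++
      ((v.map (tau p01 p11)).reverse ++ p01 :: List.replicate c p11)) := by
  simp [succList, tau, Nat.sub_add_comm hc, List.replicate_succ]

theorem succList_cons_zero_succ :
    succList p01 p11 (n + 1) (0 :: v) (c + 1) = List.replicate (n - c) p01 ++
      ((v.map (tau p01 p11)).reverse ++ p01 :: p11 :: List.replicate c p11) := by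
  simp [succList, tau, List.replicate_succ]

theorem succList_concat_one (hc : c ≤ n) :
    succList p01 p11 (n + 1) (v ++ [1]) c = p01 :: (List.replicate (n - c) p01 ++
      p11 :: ((v.map (tau p01 p11)).reverse ++ List.replicate c p11)) := by
  simp [succList, tau, Nat.sub_add_comm hc, List.replicate_succ]

theorem succList_concat_one_succ :
    succList p01 p11 (n + 1) (v ++ [1]) (c + 1) = List.replicate (n - c) p01 ++
      p11 :: ((v.map (tau p01 p11)).reverse ++ p11 :: List.replicate c p11) := by
  simp [succList, tau, List.replicate_succ]

theorem succList_concat_zero (hc : c ≤ n) :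
    succList p01 p11 (n + 1) (v ++ [0]) c = p01 :: (List.replicate (n - c) p01 ++
      p01 :: ((v.map (tau p01 p11)).reverse ++ List.replicate c p11)) := by
  simp [succList, tau, Nat.sub_add_comm hc, List.replicate_succ]

theorem succList_concat_zero_succ (hc : c ≤ n) :
    succList p01 p11 (n + 1) (v ++ [0]) (c + 1) = succList p01 p11 (n + 1) (1 :: v) c := by
  have h : List.replicate (n + 1 - c) p01 = List.replicate (n - c) p01 ++ [p01] := by
    rw [Nat.sub_add_comm hc, List.replicate_succ']
  simp [succList, tau, h, List.replicate_succ]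

theorem forall_mem_block (hp : p11 ≤ p01) (hv : ∀ x ∈ v, x ∈ Set.Icc (0 : ℝ) 1) (i j : ℕ) :
    ∀ z ∈ List.replicate i p01 ++ ((v.map (tau p01 p11)).reverse ++ List.replicate j p11),
      z ∈ Set.Icc p11 p01 := by
  intro z hz
  simp only [List.mem_append, List.mem_replicate, List.mem_reverse, List.mem_map] at hz
  rcases hz with ⟨-, rfl⟩ | ⟨x, hx, rfl⟩ | ⟨-, rfl⟩
  · exact ⟨hp, le_rfl⟩
  · exact tau_mem_Icc hp (hv x hx)
  · exact ⟨le_rfl, hp⟩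

theorem abs_succ_cons_one_sub_concat_one_le (h1 : p11 ∈ Set.Icc (0 : ℝ) 1) (hp : p11 ≤ p01)
    (hS : SwapMono p11 p01 N V) (hA : EntryAffine V) (hC : CycBound p11 p01 N γ V)
    (hv : ∀ x ∈ v, x ∈ Set.Icc (0 : ℝ) 1) (hN : n + 1 + v.length + 1 = N) (hc : c ≤ n) :
    |V (succList p01 p11 (n + 1) (1 :: v) (c + 1)) -
      V (succList p01 p11 (n + 1) (v ++ [1]) (c + 1))| ≤ γ := by
  have := hS.abs_sub_insert_lo_le hA hC h1
    (a := List.replicate (n - c) p01 ++ (v.map (tau p01 p11)).reverse)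
    (b := List.replicate (c + 1) p11) (a' := List.replicate (n - c) p01)
    (b' := (v.map (tau p01 p11)).reverse ++ List.replicate (c + 1) p11)
    (by simpa only [List.append_assoc] using forall_mem_block hp hv (n - c) (c + 1))
    (by simp; omega) (by simp)
  simpa [succList_cons_one_succ, succList_concat_one_succ, List.replicate_succ] using this

theorem abs_succ_cons_zero_sub_concat_zero_le (h0 : p01 ∈ Set.Icc (0 : ℝ) 1) (hp : p11 ≤ p01)
    (hS : SwapMono p11 p01 N V) (hA : EntryAffine V) (hC : CycBound p11 p01 N γ V)
    (hv : ∀ x ∈ v, x ∈ Set.Icc (0 : ℝ) 1) (hN : n + 1 + v.length + 1 = N) (hc : c ≤ n) :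
    |V (succList p01 p11 (n + 1) (0 :: v) c) -
      V (succList p01 p11 (n + 1) (v ++ [0]) c)| ≤ γ := by
  have := hS.abs_sub_insert_hi_le hA hC h0
    (a := List.replicate (n - c + 1) p01 ++ (v.map (tau p01 p11)).reverse)
    (b := List.replicate c p11) (a' := List.replicate (n - c + 1) p01)
    (b' := (v.map (tau p01 p11)).reverse ++ List.replicate c p11)
    (by simpa only [List.append_assoc] using forall_mem_block hp hv (n - c + 1) c)
    (by simp; omega) (by simp)
  simpa [succList_cons_zero hc, succList_concat_zero hc, List.replicate_succ] using this

/-- The sorted successor list exceeds the one in which an entry `p01` is moved back by at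
most `γ`, and not less than `0`. -/
theorem succ_cons_one_sub_cons_zero_mem_Icc (h0 : p01 ∈ Set.Icc (0 : ℝ) 1) (hp : p11 ≤ p01)
    (hS : SwapMono p11 p01 N V) (hA : EntryAffine V) (hC : CycBound p11 p01 N γ V)
    (hv : ∀ x ∈ v, x ∈ Set.Icc (0 : ℝ) 1) (hN : n + 1 + v.length + 1 = N) (hc : c ≤ n) :
    V (succList p01 p11 (n + 1) (1 :: v) c) -
      V (succList p01 p11 (n + 1) (0 :: v) (c + 1)) ∈ Set.Icc 0 γ := by
  have hblock := forall_mem_block hp hv (n - c) (c + 1)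
  have hle := hS.move_le_of_ge hA [] (List.replicate (n - c) p01 ++ (v.map (tau p01 p11)).reverse)
    (List.replicate (c + 1) p11) (x := p01)
    (fun y hy => (hblock y (by rw [← List.append_assoc]; exact List.mem_append_left _ hy)).2)
    (by simpa only [List.append_assoc, List.nil_append] using hblock) (by simp; omega)
  have habs := hS.abs_sub_insert_hi_le hA hC h0 (a := [])
    (b := List.replicate (n - c) p01 ++
      ((v.map (tau p01 p11)).reverse ++ List.replicate (c + 1) p11))
    (a' := List.replicate (n - c) p01 ++ (v.map (tau p01 p11)).reverse)
    (b' := List.replicate (c + 1) p11) hblock (by simp; omega) (by simp)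
  rw [succList_cons_one hc, succList_cons_zero_succ]
  simp only [List.replicate_succ, List.append_assoc, List.nil_append] at hle habs
  exact ⟨by linarith, (abs_le.1 habs).2⟩

theorem succ_cons_one_sub_concat_one_mem_Icc (h1 : p11 ∈ Set.Icc (0 : ℝ) 1) (hp : p11 ≤ p01)
    (hS : SwapMono p11 p01 N V) (hA : EntryAffine V) (hC : CycBound p11 p01 N γ V)
    (hv : ∀ x ∈ v, x ∈ Set.Icc (0 : ℝ) 1) (hN : n + 1 + v.length + 1 = N) (hc : c ≤ n) :
    V (succList p01 p11 (n + 1) (1 :: v) c) -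
      V (succList p01 p11 (n + 1) (v ++ [1]) c) ∈ Set.Icc 0 γ := by
  have hblock := forall_mem_block hp hv (n - c + 1) c
  have hle := hS.move_le_of_le hA (List.replicate (n - c + 1) p01) (v.map (tau p01 p11)).reverse
    (List.replicate c p11) (x := p11)
    (fun y hy => (hblock y (List.mem_append_right _ (List.mem_append_left _ hy))).1)
    hblock (by simp; omega)
  have habs := hS.abs_sub_insert_lo_le hA hC h1
    (a := List.replicate (n - c + 1) p01 ++ (v.map (tau p01 p11)).reverse)
    (b := List.replicate c p11) (a' := List.replicate (n - c + 1) p01)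
    (b' := (v.map (tau p01 p11)).reverse ++ List.replicate c p11)
    (by simpa only [List.append_assoc] using hblock) (by simp; omega) (by simp)
  rw [succList_cons_one hc, succList_concat_one hc]
  simp only [List.replicate_succ, List.append_assoc, List.cons_append] at hle habs
  exact ⟨by linarith, (abs_le.1 habs).2⟩

theorem abs_succ_cons_zero_sub_concat_one_le (h0 : p01 ∈ Set.Icc (0 : ℝ) 1)
    (h1 : p11 ∈ Set.Icc (0 : ℝ) 1) (hp : p11 ≤ p01)
    (hS : SwapMono p11 p01 N V) (hA : EntryAffine V) (hC : CycBound p11 p01 N γ V)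
    (hv : ∀ x ∈ v, x ∈ Set.Icc (0 : ℝ) 1) (hN : n + 1 + v.length + 1 = N) (hc : c ≤ n) :
    |V (succList p01 p11 (n + 1) (0 :: v) (c + 1)) -
      V (succList p01 p11 (n + 1) (v ++ [1]) c)| ≤ γ := by
  have h := succ_cons_one_sub_cons_zero_mem_Icc h0 hp hS hA hC hv hN hc
  have h' := succ_cons_one_sub_concat_one_mem_Icc h1 hp hS hA hC hv hN hc
  exact abs_le.2 ⟨by linarith [h.2, h'.1], by linarith [h.1, h'.2]⟩

end SuccList

section Step

variable {p01 p11 β γ : ℝ} {N n m s : ℕ}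

theorem listValue_succ_insert_one (u' u'' b : List ℝ) (hu : (u' ++ u'').length = n) :
    listValue p01 p11 β (n + 1) m (s + 1) (u' ++ 1 :: (u'' ++ b)) =
      bernExp (u' ++ u'') (fun c => ((min (c + 1) m : ℕ) : ℝ) +
        β * listValue p01 p11 β (n + 1) m s (succList p01 p11 (n + 1) b (c + 1))) := by
  have hl : (u' ++ 1 :: u'').length = n + 1 := by simp at hu ⊢; omega
  have h := List.take_left' (l₂ := b) hl
  have h' := List.drop_left' (l₂ := b) hl
  simp only [List.append_assoc, List.cons_append] at h h'
  rw [listValue, h, h', bernExp_append_cons]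
  ring

theorem listValue_succ_insert_zero (u' u'' b : List ℝ) (hu : (u' ++ u'').length = n) :
    listValue p01 p11 β (n + 1) m (s + 1) (u' ++ 0 :: (u'' ++ b)) =
      bernExp (u' ++ u'') (fun c => ((min c m : ℕ) : ℝ) +
        β * listValue p01 p11 β (n + 1) m s (succList p01 p11 (n + 1) b c)) := by
  have hl : (u' ++ 0 :: u'').length = n + 1 := by simp at hu ⊢; omega
  have h := List.take_left' (l₂ := b) hl
  have h' := List.drop_left' (l₂ := b) hl
  simp only [List.append_assoc, List.cons_append] at h h'
  rw [listValue, h, h', bernExp_append_cons]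
  ring

/-- Two expectations whose integrands differ by `a * rewardIncr` up to `β * γ`. -/
theorem abs_bernExp_sub_bernExp_sub_le (hβ : 0 ≤ β) {l : List ℝ}
    (hl : ∀ x ∈ l, x ∈ Set.Icc (0 : ℝ) 1) (a : ℝ) {f g X Y : ℕ → ℝ}
    (hfg : ∀ c, f c - g c = a * rewardIncr m c) (hXY : ∀ c ≤ l.length, |X c - Y c| ≤ γ) :
    |bernExp l (fun c => f c + β * X c) - bernExp l (fun c => g c + β * Y c) -
      a * bernExp l (rewardIncr m)| ≤ β * γ := by
  have h := bernExp_linear l 1 a (fun c => β * (X c - Y c)) (rewardIncr m)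
  have e : bernExp l (fun c => f c + β * X c) - bernExp l (fun c => g c + β * Y c) -
      a * bernExp l (rewardIncr m) = bernExp l (fun c => β * (X c - Y c)) := by
    rw [← bernExp_sub, sub_eq_iff_eq_add, ← one_mul (bernExp l fun c => β * (X c - Y c)), ← h]
    congr 1
    ext c
    linarith [hfg c]
  rw [e, abs_le]
  constructor
  · rw [← bernExp_const l (-(β * γ))]
    exact bernExp_mono hl fun c hc => by
      linarith [mul_le_mul_of_nonneg_left (abs_le.1 (hXY c hc)).1 hβ]
  · rw [← bernExp_const l (β * γ)]
    exact bernExp_mono hl fun c hc => mul_le_mul_of_nonneg_left (abs_le.1 (hXY c hc)).2 hβ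

theorem swapMono_listValue_succ (h0 : p01 ∈ Set.Icc (0 : ℝ) 1) (h1 : p11 ∈ Set.Icc (0 : ℝ) 1)
    (hp : p11 ≤ p01) (hβ0 : 0 ≤ β) (hk : n + 1 ≤ N) (hγ : β * γ ≤ Rlow p11 p01 m n)
    (hS : SwapMono p11 p01 N (listValue p01 p11 β (n + 1) m s))
    (hC : CycBound p11 p01 N γ (listValue p01 p11 β (n + 1) m s)) :
    SwapMono p11 p01 N (listValue p01 p11 β (n + 1) m (s + 1)) := by
  have hA : EntryAffine (listValue p01 p11 β (n + 1) m s) :=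
    fun a b x => listValue_affine p01 p11 β (n + 1) m s a b x
  have h01 : Set.Icc p11 p01 ⊆ Set.Icc 0 1 := Set.Icc_subset_Icc h1.1 h0.2
  intro a b hab hN
  have ha : ∀ x ∈ a, x ∈ Set.Icc p11 p01 := fun x hx => hab x (by simp [hx])
  have hb : ∀ x ∈ b, x ∈ Set.Icc p11 p01 := fun x hx => hab x (by simp [hx])
  rcases lt_trichotomy a.length n with h | rfl | h
  · obtain ⟨d, rfl⟩ : ∃ d, n = a.length + (d + 1) := ⟨n - a.length - 1, by omega⟩
    have e : a.length + (d + 1) + 1 = a.length + (d + 2) := by omega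
    simp only [listValue, e, List.take_length_add_append, List.drop_length_add_append,
      List.take_succ_cons, List.drop_succ_cons]
    exact (bernExp_perm (List.Perm.append_left _ (List.Perm.swap _ _ _)) _).le
  · have e1 := listValue_succ_insert_one (p01 := p01) (p11 := p11) (β := β) (m := m) (s := s)
      a [] (0 :: b) (n := a.length) (by simp)
    have e0 := listValue_succ_insert_zero (p01 := p01) (p11 := p11) (β := β) (m := m) (s := s)
      a [] (1 :: b) (n := a.length) (by simp)
    simp only [List.append_nil, List.nil_append] at e1 e0
    rw [e1, e0]
    have key := abs_bernExp_sub_bernExp_sub_le (m := m) hβ0 (fun x hx => h01 (ha x hx)) 1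
      (f := fun c => ((min (c + 1) m : ℕ) : ℝ)) (g := fun c => ((min c m : ℕ) : ℝ))
      (fun c => (one_mul _).symm) (fun c hc => by
        have := succ_cons_one_sub_cons_zero_mem_Icc h0 hp hS hA hC (fun x hx => h01 (hb x hx))
          (by simp at hN; omega) hc
        rw [abs_sub_comm, abs_of_nonneg this.1]
        exact this.2)
    have hR := (bernExp_rewardIncr_mem_Icc_Rlow_Rbar h1.1 h0.2 m ha).1
    linarith [(abs_le.1 key).1]
  · have h' : n + 1 ≤ a.length := h
    simp only [listValue, List.take_append_of_le_length h', List.drop_append_of_le_length h']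
    refine bernExp_mono (fun x hx => h01 (ha x (List.mem_of_mem_take hx))) fun c hc => ?_
    have hc' : c ≤ n + 1 := hc.trans (List.length_take_le _ _)
    have := hS.swap_le hA (a := List.replicate (n + 1 - c) p01 ++ (b.map (tau p01 p11)).reverse)
      (b := ((a.drop (n + 1)).map (tau p01 p11)).reverse ++ List.replicate c p11)
      (x := tau p01 p11 0) (y := tau p01 p11 1)
      (by
        have := forall_mem_block hp (v := a.drop (n + 1) ++ b) (i := n + 1 - c) (j := c)
          (fun x hx => h01 (hab x (by
            rcases List.mem_append.1 hx with hx | hx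
            · simp [List.mem_of_mem_drop hx]
            · simp [hx])))
        simpa using this)
      (by simp at hN ⊢; omega) (by simpa [tau] using hp)
    refine add_le_add_right (mul_le_mul_of_nonneg_left ?_ hβ0) _
    simpa [succList] using this

theorem cycBound_listValue_succ (h0 : p01 ∈ Set.Icc (0 : ℝ) 1) (h1 : p11 ∈ Set.Icc (0 : ℝ) 1)
    (hp : p11 ≤ p01) (hβ0 : 0 ≤ β) (hk : n + 1 ≤ N)
    (hγ0 : 0 ≤ γ) (hγ : Rbar p11 p01 m n + β * γ ≤ γ)
    (hS : SwapMono p11 p01 N (listValue p01 p11 β (n + 1) m s))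
    (hC : CycBound p11 p01 N γ (listValue p01 p11 β (n + 1) m s)) :
    CycBound p11 p01 N γ (listValue p01 p11 β (n + 1) m (s + 1)) := by
  have hA : EntryAffine (listValue p01 p11 β (n + 1) m s) :=
    fun a b x => listValue_affine p01 p11 β (n + 1) m s a b x
  have h01 : Set.Icc p11 p01 ⊆ Set.Icc 0 1 := Set.Icc_subset_Icc h1.1 h0.2
  intro w hw hN x hx
  rcases hk.eq_or_lt with hk | hk
  · have e₁ : (x :: w).length ≤ n + 1 := by simp; omega
    have e₂ : (w ++ [x]).length ≤ n + 1 := by simp; omega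
    rw [listValue, listValue, List.take_of_length_le e₁, List.take_of_length_le e₂,
      List.drop_of_length_le e₁, List.drop_of_length_le e₂,
      bernExp_perm (List.perm_append_singleton x w).symm, sub_self, abs_zero]
    exact hγ0
  obtain ⟨u, y, v, rfl, rfl⟩ : ∃ u y v, w = u ++ y :: v ∧ u.length = n :=
    ⟨w.take n, w[n], w.drop (n + 1), by simp, by simp; omega⟩
  have hu : ∀ z ∈ u, z ∈ Set.Icc p11 p01 := fun z hz => hw z (by simp [hz])
  have hv : ∀ z ∈ v, z ∈ Set.Icc (0 : ℝ) 1 := fun z hz => h01 (hw z (by simp [hz]))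
  have hu01 : ∀ z ∈ u, z ∈ Set.Icc (0 : ℝ) 1 := fun z hz => h01 (hu z hz)
  have hy : y ∈ Set.Icc (0 : ℝ) 1 := h01 (hw y (by simp))
  have hN' : u.length + 1 + v.length + 1 = N := by simp at hN; omega
  have hR := (bernExp_rewardIncr_mem_Icc_Rlow_Rbar h1.1 h0.2 m hu).2
  have hR0 := (bernExp_rewardIncr_mem_Icc m hu01).1
  set F := listValue p01 p11 β (u.length + 1) m (s + 1) with hF
  have hone := fun b => listValue_succ_insert_one (p01 := p01) (p11 := p11) (β := β) (m := m)
    (s := s) [] u b (n := u.length) (by simp)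
  have hzero := fun b => listValue_succ_insert_zero (p01 := p01) (p11 := p11) (β := β) (m := m)
    (s := s) [] u b (n := u.length) (by simp)
  have hone' := fun b => listValue_succ_insert_one (p01 := p01) (p11 := p11) (β := β) (m := m)
    (s := s) u [] b (n := u.length) (by simp)
  have hzero' := fun b => listValue_succ_insert_zero (p01 := p01) (p11 := p11) (β := β) (m := m)
    (s := s) u [] b (n := u.length) (by simp)
  simp only [List.nil_append, List.append_nil, ← hF] at hone hzero hone' hzero'
  have q11 : |F (1 :: (u ++ 1 :: v)) - F (u ++ 1 :: (v ++ [1]))| ≤ γ := by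
    rw [hone, hone']
    have := abs_le.1 <| abs_bernExp_sub_bernExp_sub_le (m := m) hβ0 hu01 0
      (f := fun c => ((min (c + 1) m : ℕ) : ℝ)) (g := fun c => ((min (c + 1) m : ℕ) : ℝ))
      (fun c => by simp)
      (fun c hc => abs_succ_cons_one_sub_concat_one_le h1 hp hS hA hC hv hN' hc)
    exact abs_le.2 ⟨by linarith [this.1], by linarith [this.2]⟩
  have q10 : |F (1 :: (u ++ 0 :: v)) - F (u ++ 0 :: (v ++ [1]))| ≤ γ := by
    rw [hone, hzero']
    have := abs_le.1 <| abs_bernExp_sub_bernExp_sub_le (m := m) hβ0 hu01 1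
      (f := fun c => ((min (c + 1) m : ℕ) : ℝ)) (g := fun c => ((min c m : ℕ) : ℝ))
      (fun c => (one_mul _).symm)
      (fun c hc => abs_succ_cons_zero_sub_concat_one_le h0 h1 hp hS hA hC hv hN' hc)
    exact abs_le.2 ⟨by linarith [this.1], by linarith [this.2]⟩
  have q01 : |F (0 :: (u ++ 1 :: v)) - F (u ++ 1 :: (v ++ [0]))| ≤ γ := by
    rw [hzero, hone']
    have := abs_le.1 <| abs_bernExp_sub_bernExp_sub_le (m := m) (γ := γ) hβ0 hu01 (-1)
      (f := fun c => ((min c m : ℕ) : ℝ)) (g := fun c => ((min (c + 1) m : ℕ) : ℝ))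
      (X := fun c => listValue p01 p11 β (u.length + 1) m s (succList p01 p11 _ (1 :: v) c))
      (Y := fun c =>
        listValue p01 p11 β (u.length + 1) m s (succList p01 p11 _ (v ++ [0]) (c + 1)))
      (fun c => by rw [rewardIncr]; ring)
      (fun c hc => by rw [succList_concat_zero_succ hc, sub_self, abs_zero]; exact hγ0)
    exact abs_le.2 ⟨by linarith [this.1], by linarith [this.2]⟩
  have q00 : |F (0 :: (u ++ 0 :: v)) - F (u ++ 0 :: (v ++ [0]))| ≤ γ := by
    rw [hzero, hzero']
    have := abs_le.1 <| abs_bernExp_sub_bernExp_sub_le (m := m) hβ0 hu01 0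
      (f := fun c => ((min c m : ℕ) : ℝ)) (g := fun c => ((min c m : ℕ) : ℝ))
      (fun c => by simp)
      (fun c hc => abs_succ_cons_zero_sub_concat_zero_le h0 hp hS hA hC hv hN' hc)
    exact abs_le.2 ⟨by linarith [this.1], by linarith [this.2]⟩
  have hFA : EntryAffine F := fun a b z => listValue_affine p01 p11 β _ m (s + 1) a b z
  have hfront : F (x :: (u ++ y :: v)) =
      x * (y * F (1 :: (u ++ 1 :: v)) + (1 - y) * F (1 :: (u ++ 0 :: v))) +
      (1 - x) * (y * F (0 :: (u ++ 1 :: v)) + (1 - y) * F (0 :: (u ++ 0 :: v))) := by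
    have e := hFA [] (u ++ y :: v) x
    have e1 := hFA (1 :: u) v y
    have e0 := hFA (0 :: u) v y
    simp only [List.nil_append, List.cons_append] at e e1 e0
    rw [e, e1, e0]
  have hback : F ((u ++ y :: v) ++ [x]) =
      x * (y * F (u ++ 1 :: (v ++ [1])) + (1 - y) * F (u ++ 0 :: (v ++ [1]))) +
      (1 - x) * (y * F (u ++ 1 :: (v ++ [0])) + (1 - y) * F (u ++ 0 :: (v ++ [0]))) := by
    rw [hFA, List.append_assoc, List.append_assoc, List.cons_append, List.cons_append,
      hFA u (v ++ [1]) y, hFA u (v ++ [0]) y]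
  have hcomb := abs_convex_combination_le hx (abs_convex_combination_le hy q11 q10)
    (abs_convex_combination_le hy q01 q00)
  rw [hfront, hback]
  convert hcomb using 2
  ring

theorem swapMono_and_cycBound_listValue (h0 : p01 ∈ Set.Icc (0 : ℝ) 1)
    (h1 : p11 ∈ Set.Icc (0 : ℝ) 1) (hp : p11 ≤ p01) (hβ0 : 0 ≤ β) (hk : n + 1 ≤ N)
    (hγ0 : 0 ≤ γ) (hlow : β * γ ≤ Rlow p11 p01 m n) (hbar : Rbar p11 p01 m n + β * γ ≤ γ)
    (s : ℕ) :
    SwapMono p11 p01 N (listValue p01 p11 β (n + 1) m s) ∧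
      CycBound p11 p01 N γ (listValue p01 p11 β (n + 1) m s) := by
  induction s with
  | zero =>
    exact ⟨fun _ _ _ _ => le_rfl, fun _ _ _ _ _ => by simpa [listValue] using hγ0⟩
  | succ s ih =>
    exact ⟨swapMono_listValue_succ h0 h1 hp hβ0 hk hlow ih.1 ih.2,
      cycBound_listValue_succ h0 h1 hp hβ0 hk hγ0 hbar ih.1 ih.2⟩

end Step

/-- key inequality L4 for negatively correlated channels:
`γ + W_t(ω_N, ω_1, …, ω_{N-1}) ≥ W_t(ω_1, …, ω_N)` where `γ = ℛ̄/(1-β)`. -/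
theorem Wneg_L4 (p01 p11 β : ℝ) (h0 : p01 ∈ Set.Icc (0 : ℝ) 1)
    (h1 : p11 ∈ Set.Icc (0 : ℝ) 1) (hp : p11 ≤ p01)
    (N k m T : ℕ) (hm : 1 ≤ m) (hmk : m ≤ k) (hkN : k ≤ N) (hT : 1 ≤ T)
    (hβ0 : 0 ≤ β) (hβ1 : β < 1)
    (hcond : β * (Rlow p11 p01 m (k - 1) + Rbar p11 p01 m (k - 1)) ≤
      Rlow p11 p01 m (k - 1)) :
    ∀ γ : ℝ, γ = Rbar p11 p01 m (k - 1) / (1 - β) →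
    ∀ t, 1 ≤ t → t ≤ T → ∀ ω : Fin N → ℝ,
      (∀ i, ω i ∈ Set.Icc p11 p01) → Antitone ω →
      γ + Wneg p01 p11 β N k m (T - t) (cycR ω) ≥
        Wneg p01 p11 β N k m (T - t) ω := by
  rintro γ rfl t - - ω hω -
  obtain ⟨n, rfl⟩ : ∃ n, k = n + 1 := ⟨k - 1, by omega⟩
  obtain ⟨M, rfl⟩ : ∃ M, N = M + 1 := ⟨N - 1, by omega⟩
  simp only [Nat.add_sub_cancel] at hcond ⊢
  have hβ : 0 < 1 - β := by linarith
  have hRbar : 0 ≤ Rbar p11 p01 m n :=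
    Real.sSup_nonneg fun r hr => (RdiffSet_subset_Icc h1.1 h0.2 m n hr).1
  set γ := Rbar p11 p01 m n / (1 - β) with hγ
  have hγR : γ * (1 - β) = Rbar p11 p01 m n := div_mul_cancel₀ _ hβ.ne'
  have hlow : β * γ ≤ Rlow p11 p01 m n := by
    rw [hγ, ← mul_div_assoc, div_le_iff₀ hβ]
    linarith
  have hC := (swapMono_and_cycBound_listValue h0 h1 hp hβ0 hkN (div_nonneg hRbar hβ.le) hlow
    (by linarith) (T - t + 1)).2
  have h := hC (List.ofFn fun i : Fin M => ω i.castSucc)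
    (fun x hx => by
      obtain ⟨i, rfl⟩ := (List.mem_ofFn' _ _).1 hx
      exact hω _)
    (by simp) (ω (Fin.last M)) (Set.Icc_subset_Icc h1.1 h0.2 (hω _))
  rw [Wneg_eq_listValue _ _ _ hkN, Wneg_eq_listValue _ _ _ hkN, ofFn_cycR,
    List.ofFn_succ' ω, List.concat_eq_append]
  linarith [(abs_le.1 h).1]
end

section
/- Key inequality L5 (adjacent-swap inequality) for negatively correlated channels: assume p11 ≤ p01, 0 ≤ β < 1, and β·(ℛ̲ + ℛ̄) ≤ ℛ̲. Then for every t ∈ {1,…,T}, every j ∈ {1,…,N−1}, every belief vector ω ∈ [0,1]^N with p01 ≥ ω₁ ≥ ω₂ ≥ … ≥ ω_N ≥ p11, and every x, y ∈ [p11, p01] with x ≥ y, it holds that W_t(ω₁, …, ω_{j−1}, x, y, ω_{j+2}, …, ω_N) ≥ W_t(ω₁, …, ω_{j−1}, y, x, ω_{j+2}, …, ω_N). -/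
open Finset

namespace Bandit

/-- The expectation of `f` at the number of successes among independent Bernoulli trials with the
listed success probabilities. -/
def bernoulliE : List ℝ → (ℕ → ℝ) → ℝ
  | [], f => f 0
  | a :: L, f => a * bernoulliE L (fun c => f (c + 1)) + (1 - a) * bernoulliE L f

theorem bernoulliE_perm {L L' : List ℝ} (h : L.Perm L') (f : ℕ → ℝ) :
    bernoulliE L f = bernoulliE L' f := by
  induction h generalizing f with
  | nil => rfl
  | cons a _ ih => simp only [bernoulliE, ih]
  | swap a b L => simp only [bernoulliE]; ring
  | trans _ _ ih₁ ih₂ => rw [ih₁, ih₂]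

theorem bernoulliE_concat (L : List ℝ) (a : ℝ) (f : ℕ → ℝ) :
    bernoulliE (L ++ [a]) f =
      a * bernoulliE L (fun c => f (c + 1)) + (1 - a) * bernoulliE L f :=
  bernoulliE_perm (List.perm_append_singleton a L) f

theorem bernoulliE_add (L : List ℝ) (f g : ℕ → ℝ) :
    bernoulliE L (fun c => f c + g c) = bernoulliE L f + bernoulliE L g := by
  induction L generalizing f g with
  | nil => rfl
  | cons a L ih =>
    simp only [bernoulliE, ih]
    ring

theorem bernoulliE_const_mul (L : List ℝ) (b : ℝ) (f : ℕ → ℝ) :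
    bernoulliE L (fun c => b * f c) = b * bernoulliE L f := by
  induction L generalizing f with
  | nil => rfl
  | cons a L ih =>
    simp only [bernoulliE, ih]
    ring

theorem bernoulliE_const (L : List ℝ) (b : ℝ) : bernoulliE L (fun _ => b) = b := by
  induction L with
  | nil => rfl
  | cons a L ih => simp only [bernoulliE, ih]; ring

theorem bernoulliE_sub (L : List ℝ) (f g : ℕ → ℝ) :
    bernoulliE L (fun c => f c - g c) = bernoulliE L f - bernoulliE L g := by
  have h := bernoulliE_add L (fun c => f c - g c) g
  simp only [sub_add_cancel] at h
  exact eq_sub_of_add_eq h.symm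

theorem bernoulliE_mono {L : List ℝ} (hL : ∀ a ∈ L, a ∈ Set.Icc (0 : ℝ) 1) {f g : ℕ → ℝ}
    (h : ∀ c ≤ L.length, f c ≤ g c) : bernoulliE L f ≤ bernoulliE L g := by
  induction L generalizing f g with
  | nil => exact h 0 le_rfl
  | cons a L ih =>
    have ha := hL a (by simp)
    have hL' : ∀ b ∈ L, b ∈ Set.Icc (0 : ℝ) 1 := fun b hb => hL b (by simp [hb])
    have h₁ := ih hL' (f := fun c => f (c + 1)) (g := fun c => g (c + 1))
      fun c hc => h _ (by simpa using hc)
    have h₂ := ih hL' (f := f) (g := g) fun c hc => h _ (by simp; omega)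
    exact add_le_add (mul_le_mul_of_nonneg_left h₁ ha.1)
      (mul_le_mul_of_nonneg_left h₂ (by linarith [ha.2]))

theorem sum_powerset_eq_bernoulliE {ι : Type*} [DecidableEq ι] (ω : ι → ℝ) (L : List ι)
    (hL : L.Nodup) (f : ℕ → ℝ) :
    ∑ A ∈ L.toFinset.powerset, (∏ i ∈ A, ω i) * (∏ i ∈ L.toFinset \ A, (1 - ω i)) * f A.card =
      bernoulliE (L.map ω) f := by
  induction L generalizing f with
  | nil => simp [bernoulliE]
  | cons a L ih =>
    rw [List.nodup_cons] at hL
    have ha : a ∉ L.toFinset := by simpa using hL.1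
    rw [List.toFinset_cons, Finset.sum_powerset_insert ha, List.map_cons, bernoulliE,
      ← ih hL.2, ← ih hL.2, Finset.mul_sum, Finset.mul_sum, add_comm]
    congr 1
    · refine Finset.sum_congr rfl fun A hA => ?_
      have haA : a ∉ A := fun h => ha (Finset.mem_powerset.1 hA h)
      have : insert a L.toFinset \ insert a A = L.toFinset \ A := by
        ext i; simp only [Finset.mem_sdiff, Finset.mem_insert]; grind
      rw [this, Finset.prod_insert haA, Finset.card_insert_of_notMem haA]
      ring
    · refine Finset.sum_congr rfl fun A hA => ?_
      have haA : a ∉ A := fun h => ha (Finset.mem_powerset.1 hA h)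
      rw [Finset.insert_sdiff_of_notMem _ haA, Finset.prod_insert (by simp [ha])]
      ring

/-- The list form of `nextNeg`: the successor beliefs after `c` successes among `k` sensed
channels, when `L` lists the beliefs of the channels which were not sensed. -/
def nextList (p q : ℝ) (k : ℕ) (L : List ℝ) (c : ℕ) : List ℝ :=
  List.replicate (k - c) p ++ (L.reverse.map (tau p q) ++ List.replicate c q)

/-- One step of the myopic recursion with reward `r` and continuation value `V`. -/
def stepValue (p q β : ℝ) (r : ℕ → ℝ) (k : ℕ) (V : List ℝ → ℝ) (L : List ℝ) : ℝ :=
  bernoulliE (L.take k) fun c => r c + β * V (nextList p q k (L.drop k) c)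

theorem stepValue_append (p q β : ℝ) (r : ℕ → ℝ) (V : List ℝ → ℝ) (A C : List ℝ) :
    stepValue p q β r A.length V (A ++ C) =
      bernoulliE A fun c => r c + β * V (nextList p q A.length C c) := by
  simp [stepValue]

/-- `V` is affine in each entry of the belief list. -/
def IsMultiaffine (V : List ℝ → ℝ) : Prop :=
  ∀ (A C : List ℝ) (a : ℝ), V (A ++ a :: C) = a * V (A ++ 1 :: C) + (1 - a) * V (A ++ 0 :: C)

/-- Among belief lists in `[q, p]`, swapping adjacent entries into descending order does not
decrease `V`. -/
def IsSwapMonotone (p q : ℝ) (V : List ℝ → ℝ) : Prop :=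
  ∀ (A C : List ℝ) (x y : ℝ), (∀ z ∈ A, z ∈ Set.Icc q p) → (∀ z ∈ C, z ∈ Set.Icc q p) →
    x ∈ Set.Icc q p → y ∈ Set.Icc q p → y ≤ x → V (A ++ y :: x :: C) ≤ V (A ++ x :: y :: C)

/-- Among belief lists in `[q, p]` of length at least `k + 1`, a cyclic rotation by one place
changes `V` by at most `M`. -/
def IsRotationBounded (p q M : ℝ) (k : ℕ) (V : List ℝ → ℝ) : Prop :=
  ∀ (L : List ℝ) (a : ℝ), (∀ z ∈ L, z ∈ Set.Icc q p) → a ∈ Set.Icc q p → k ≤ L.length →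
    |V (a :: L) - V (L ++ [a])| ≤ M

theorem IsMultiaffine.stepValue {V : List ℝ → ℝ} (hV : IsMultiaffine V) (p q β : ℝ)
    (r : ℕ → ℝ) (k : ℕ) : IsMultiaffine (stepValue p q β r k V) := by
  intro A C a
  rcases lt_or_ge A.length k with h | h
  · obtain ⟨j, rfl⟩ : ∃ j, k = A.length + (j + 1) := ⟨k - A.length - 1, by omega⟩
    have key (b : ℝ) (f : ℕ → ℝ) : bernoulliE (A ++ b :: C.take j) f =
        b * bernoulliE (A ++ C.take j) (fun c => f (c + 1)) +
          (1 - b) * bernoulliE (A ++ C.take j) f :=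
      bernoulliE_perm List.perm_middle f
    simp only [Bandit.stepValue, List.take_length_add_append, List.drop_length_add_append,
      List.take_succ_cons, List.drop_succ_cons, key]
    ring
  · have key (b : ℝ) (c : ℕ) : V (nextList p q k ((A ++ b :: C).drop k) c) =
        b * V (nextList p q k ((A ++ 1 :: C).drop k) c) +
          (1 - b) * V (nextList p q k ((A ++ 0 :: C).drop k) c) := by
      have h' (b : ℝ) : nextList p q k ((A ++ b :: C).drop k) c =
          (List.replicate (k - c) p ++ C.reverse.map (tau p q)) ++ tau p q b ::
            ((A.drop k).reverse.map (tau p q) ++ List.replicate c q) := by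
        simp [nextList, List.drop_append_of_le_length h]
      rw [h', h', h', hV _ _ (tau p q b), hV _ _ (tau p q 1), hV _ _ (tau p q 0)]
      simp only [tau]
      ring
    simp only [Bandit.stepValue, List.take_append_of_le_length h, bernoulliE_add,
      bernoulliE_const_mul, key a]
    ring

section Moves

variable {p q M : ℝ} {k : ℕ} {V : List ℝ → ℝ}

theorem IsSwapMonotone.le_move_left (hV : IsSwapMonotone p q V) {A B C : List ℝ} {x : ℝ}
    (hA : ∀ z ∈ A, z ∈ Set.Icc q p) (hB : ∀ z ∈ B, z ∈ Set.Icc q p)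
    (hC : ∀ z ∈ C, z ∈ Set.Icc q p) (hx : x ∈ Set.Icc q p) (hBx : ∀ z ∈ B, z ≤ x) :
    V (A ++ (B ++ x :: C)) ≤ V (A ++ x :: (B ++ C)) := by
  induction B generalizing A with
  | nil => simp
  | cons b B ih =>
    simp only [List.forall_mem_cons] at hB hBx
    have h₁ := ih (A := A ++ [b]) (by simp only [List.forall_mem_append]; simp_all) hB.2 hBx.2
    have h₂ := hV A (B ++ C) x b hA (by simp only [List.forall_mem_append]; exact ⟨hB.2, hC⟩)
      hx hB.1 hBx.1
    simp only [List.append_assoc, List.cons_append, List.nil_append] at h₁ h₂ ⊢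
    exact h₁.trans h₂

theorem IsSwapMonotone.move_left_le (hV : IsSwapMonotone p q V) {A B C : List ℝ} {x : ℝ}
    (hA : ∀ z ∈ A, z ∈ Set.Icc q p) (hB : ∀ z ∈ B, z ∈ Set.Icc q p)
    (hC : ∀ z ∈ C, z ∈ Set.Icc q p) (hx : x ∈ Set.Icc q p) (hBx : ∀ z ∈ B, x ≤ z) :
    V (A ++ x :: (B ++ C)) ≤ V (A ++ (B ++ x :: C)) := by
  induction B generalizing A with
  | nil => simp
  | cons b B ih =>
    simp only [List.forall_mem_cons] at hB hBx
    have h₁ := ih (A := A ++ [b]) (by simp only [List.forall_mem_append]; simp_all) hB.2 hBx.2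
    have h₂ := hV A (B ++ C) b x hA (by simp only [List.forall_mem_append]; exact ⟨hB.2, hC⟩)
      hB.1 hx hBx.1
    simp only [List.append_assoc, List.cons_append, List.nil_append] at h₁ h₂ ⊢
    exact h₂.trans h₁

theorem move_top_bounds (hqp : q ≤ p) (hV : IsSwapMonotone p q V)
    (hM : IsRotationBounded p q M k V) {A B C : List ℝ}
    (hA : ∀ z ∈ A, z ∈ Set.Icc q p) (hB : ∀ z ∈ B, z ∈ Set.Icc q p)
    (hC : ∀ z ∈ C, z ∈ Set.Icc q p) (hk : k ≤ A.length + (B.length + C.length)) :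
    0 ≤ V (A ++ p :: (B ++ C)) - V (A ++ (B ++ p :: C)) ∧
      V (A ++ p :: (B ++ C)) - V (A ++ (B ++ p :: C)) ≤ M := by
  have hp : p ∈ Set.Icc q p := ⟨hqp, le_rfl⟩
  have hAB : ∀ z ∈ A ++ B, z ∈ Set.Icc q p := List.forall_mem_append.2 ⟨hA, hB⟩
  have hBC : ∀ z ∈ B ++ C, z ∈ Set.Icc q p := List.forall_mem_append.2 ⟨hB, hC⟩
  have h₁ := hV.le_move_left hA hB hC hp fun z hz => (hB z hz).2
  have h₂ := hV.le_move_left (A := []) (by simp) hA hBC hp fun z hz => (hA z hz).2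
  have h₃ := hV.le_move_left (C := []) hAB hC (by simp) hp fun z hz => (hC z hz).2
  have h₄ := hM (A ++ (B ++ C)) p (List.forall_mem_append.2 ⟨hA, hBC⟩) hp (by simpa using hk)
  simp only [List.append_assoc, List.nil_append, List.append_nil] at h₁ h₂ h₃ h₄ ⊢
  rw [abs_le] at h₄
  constructor <;> linarith

theorem move_bot_bounds (hqp : q ≤ p) (hV : IsSwapMonotone p q V)
    (hM : IsRotationBounded p q M k V) {A B C : List ℝ}
    (hA : ∀ z ∈ A, z ∈ Set.Icc q p) (hB : ∀ z ∈ B, z ∈ Set.Icc q p)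
    (hC : ∀ z ∈ C, z ∈ Set.Icc q p) (hk : k ≤ A.length + (B.length + C.length)) :
    0 ≤ V (A ++ (B ++ q :: C)) - V (A ++ q :: (B ++ C)) ∧
      V (A ++ (B ++ q :: C)) - V (A ++ q :: (B ++ C)) ≤ M := by
  have hq : q ∈ Set.Icc q p := ⟨le_rfl, hqp⟩
  have hAB : ∀ z ∈ A ++ B, z ∈ Set.Icc q p := List.forall_mem_append.2 ⟨hA, hB⟩
  have hBC : ∀ z ∈ B ++ C, z ∈ Set.Icc q p := List.forall_mem_append.2 ⟨hB, hC⟩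
  have h₁ := hV.move_left_le hA hB hC hq fun z hz => (hB z hz).1
  have h₂ := hV.move_left_le (A := []) (by simp) hA hBC hq fun z hz => (hA z hz).1
  have h₃ := hV.move_left_le (C := []) hAB hC (by simp) hq fun z hz => (hC z hz).1
  have h₄ := hM (A ++ (B ++ C)) q (List.forall_mem_append.2 ⟨hA, hBC⟩) hq (by simpa using hk)
  simp only [List.append_assoc, List.nil_append, List.append_nil] at h₁ h₂ h₃ h₄ ⊢
  rw [abs_le] at h₄
  constructor <;> linarith

end Moves

theorem tau_one (p q : ℝ) : tau p q 1 = q := by simp [tau]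

theorem tau_zero (p q : ℝ) : tau p q 0 = p := by simp [tau]

theorem tau_mem {p q : ℝ} (hqp : q ≤ p) {x : ℝ} (hx : x ∈ Set.Icc (0 : ℝ) 1) :
    tau p q x ∈ Set.Icc q p := by
  obtain ⟨h₀, h₁⟩ := hx
  constructor <;> simp only [tau] <;> nlinarith

theorem tau_anti {p q : ℝ} (hqp : q ≤ p) {x y : ℝ} (h : y ≤ x) : tau p q x ≤ tau p q y := by
  simp only [tau]; nlinarith

theorem mem_of_mem_replicate {s : Set ℝ} {a : ℝ} (ha : a ∈ s) (n : ℕ) :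
    ∀ z ∈ List.replicate n a, z ∈ s := fun _ hz => List.eq_of_mem_replicate hz ▸ ha

section Successor

variable (p q : ℝ) {n c : ℕ} (C : List ℝ)

theorem nextList_succ_cons_one : nextList p q (n + 1) (1 :: C) (c + 1) =
    List.replicate (n - c) p ++ (C.reverse.map (tau p q) ++ q :: q :: List.replicate c q) := by
  simp [nextList, tau_one, List.replicate_succ]

theorem nextList_succ_cons_zero : nextList p q (n + 1) (0 :: C) (c + 1) =
    List.replicate (n - c) p ++ (C.reverse.map (tau p q) ++ p :: q :: List.replicate c q) := by
  simp [nextList, tau_zero, List.replicate_succ]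

theorem nextList_cons_one (hc : c ≤ n) : nextList p q (n + 1) (1 :: C) c =
    List.replicate (n - c) p ++ p :: (C.reverse.map (tau p q) ++ q :: List.replicate c q) := by
  simp [nextList, tau_one, Nat.succ_sub hc, List.replicate_succ']

theorem nextList_cons_zero (hc : c ≤ n) : nextList p q (n + 1) (0 :: C) c =
    List.replicate (n - c) p ++ p :: (C.reverse.map (tau p q) ++ p :: List.replicate c q) := by
  simp [nextList, tau_zero, Nat.succ_sub hc, List.replicate_succ']

theorem nextList_succ_concat_one : nextList p q (n + 1) (C ++ [1]) (c + 1) =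
    List.replicate (n - c) p ++ q :: (C.reverse.map (tau p q) ++ q :: List.replicate c q) := by
  simp [nextList, tau_one, List.replicate_succ]

theorem nextList_succ_concat_zero : nextList p q (n + 1) (C ++ [0]) (c + 1) =
    List.replicate (n - c) p ++ p :: (C.reverse.map (tau p q) ++ q :: List.replicate c q) := by
  simp [nextList, tau_zero, List.replicate_succ]

theorem nextList_concat_one (hc : c ≤ n) : nextList p q (n + 1) (C ++ [1]) c =
    List.replicate (n - c) p ++ p :: q :: (C.reverse.map (tau p q) ++ List.replicate c q) := by
  simp [nextList, tau_one, Nat.succ_sub hc, List.replicate_succ']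

theorem nextList_concat_zero (hc : c ≤ n) : nextList p q (n + 1) (C ++ [0]) c =
    List.replicate (n - c) p ++ p :: p :: (C.reverse.map (tau p q) ++ List.replicate c q) := by
  simp [nextList, tau_zero, Nat.succ_sub hc, List.replicate_succ']

end Successor

section Step

variable {p q β M Rl Rb : ℝ} {n : ℕ} {r : ℕ → ℝ} {V : List ℝ → ℝ}

/-- The value of a step in which the sensed channels have beliefs `x` and `A`, expanded in the
belief `x` and the belief `y` of an unsensed channel. -/
theorem bernoulliE_step_expand (hV : IsMultiaffine V) (A B D : List ℝ) (x y : ℝ) :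
    bernoulliE (x :: A) (fun c => r c + β * V (nextList p q (n + 1) (B ++ y :: D) c)) =
      x * y * bernoulliE A
        (fun c => r (c + 1) + β * V (nextList p q (n + 1) (B ++ 1 :: D) (c + 1))) +
      x * (1 - y) * bernoulliE A
        (fun c => r (c + 1) + β * V (nextList p q (n + 1) (B ++ 0 :: D) (c + 1))) +
      (1 - x) * y * bernoulliE A
        (fun c => r c + β * V (nextList p q (n + 1) (B ++ 1 :: D) c)) +
      (1 - x) * (1 - y) * bernoulliE A
        (fun c => r c + β * V (nextList p q (n + 1) (B ++ 0 :: D) c)) := by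
  have key (c : ℕ) : V (nextList p q (n + 1) (B ++ y :: D) c) =
      y * V (nextList p q (n + 1) (B ++ 1 :: D) c) +
        (1 - y) * V (nextList p q (n + 1) (B ++ 0 :: D) c) := by
    have h (b : ℝ) : nextList p q (n + 1) (B ++ b :: D) c =
        (List.replicate (n + 1 - c) p ++ D.reverse.map (tau p q)) ++ tau p q b ::
          (B.reverse.map (tau p q) ++ List.replicate c q) := by
      simp [nextList]
    rw [h, h, h, hV _ _ (tau p q y), hV _ _ (tau p q 1), hV _ _ (tau p q 0)]
    simp only [tau]
    ring
  simp only [bernoulliE, key, bernoulliE_add, bernoulliE_const_mul]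
  ring

theorem IsSwapMonotone.stepValue (hq : 0 ≤ q) (hqp : q ≤ p) (hp : p ≤ 1) (hβ : 0 ≤ β)
    (hRl : ∀ A : List ℝ, A.length = n → (∀ z ∈ A, z ∈ Set.Icc q p) →
      Rl ≤ bernoulliE A fun c => r (c + 1) - r c)
    (hMl : β * M ≤ Rl) (hVa : IsMultiaffine V) (hVs : IsSwapMonotone p q V)
    (hVr : IsRotationBounded p q M (n + 1) V) :
    IsSwapMonotone p q (stepValue p q β r (n + 1) V) := by
  have hI : Set.Icc q p ⊆ Set.Icc (0 : ℝ) 1 := Set.Icc_subset_Icc hq hp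
  have hτ {L : List ℝ} (hL : ∀ z ∈ L, z ∈ Set.Icc q p) :
      ∀ z ∈ L.reverse.map (tau p q), z ∈ Set.Icc q p := by
    intro z hz
    obtain ⟨w, hw, rfl⟩ := List.mem_map.1 hz
    exact tau_mem hqp (hI (hL w (List.mem_reverse.1 hw)))
  have hpI : p ∈ Set.Icc q p := ⟨hqp, le_rfl⟩
  have hqI : q ∈ Set.Icc q p := ⟨le_rfl, hqp⟩
  intro A C x y hA hC hx hy hyx
  rcases lt_trichotomy A.length n with h | h | h
  · obtain ⟨j, hj⟩ : ∃ j, n + 1 = A.length + (j + 2) := ⟨n - A.length - 1, by omega⟩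
    simp only [Bandit.stepValue, hj, List.take_length_add_append, List.drop_length_add_append,
      List.take_succ_cons, List.drop_succ_cons]
    exact (bernoulliE_perm ((List.Perm.swap x y _).append_left A) _).le
  · have step (x y : ℝ) : Bandit.stepValue p q β r (n + 1) V (A ++ x :: y :: C) =
        bernoulliE (x :: A)
          fun c => r c + β * V (nextList p q (n + 1) ([] ++ y :: C) c) := by
      have := stepValue_append p q β r V (A ++ [x]) (y :: C)
      simp only [List.append_assoc, List.cons_append, List.nil_append, List.length_append,
        List.length_singleton, h] at this ⊢
      rw [this]
      exact bernoulliE_perm (List.perm_append_singleton x A) _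
    rw [step, step, bernoulliE_step_expand hVa, bernoulliE_step_expand hVa]
    have key : bernoulliE A
          (fun c => r c + β * V (nextList p q (n + 1) ([] ++ 1 :: C) c)) ≤
        bernoulliE A
          (fun c => r (c + 1) + β * V (nextList p q (n + 1) ([] ++ 0 :: C) (c + 1))) := by
      have hle : bernoulliE A
            (fun c => r c + β * V (nextList p q (n + 1) ([] ++ 1 :: C) c)) ≤
          bernoulliE A (fun c =>
            (r (c + 1) + β * V (nextList p q (n + 1) ([] ++ 0 :: C) (c + 1))) -
              (r (c + 1) - r c) + β * M) := by
        refine bernoulliE_mono (fun z hz => hI (hA z hz)) fun c hc => ?_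
        rw [h] at hc
        simp only [List.nil_append]
        rw [nextList_cons_one p q C hc, nextList_succ_cons_zero]
        have := (move_top_bounds hqp hVs hVr (mem_of_mem_replicate hpI (n - c)) (hτ hC)
          (C := q :: List.replicate c q)
          (List.forall_mem_cons.2 ⟨hqI, mem_of_mem_replicate hqI c⟩)
          (by simp; omega)).2
        nlinarith
      rw [bernoulliE_add A (fun c => _ - _), bernoulliE_sub A (fun c => r (c + 1) + _),
        bernoulliE_const] at hle
      linarith [hRl A h hA]
    nlinarith
  · have h' : n + 1 ≤ A.length := h
    simp only [Bandit.stepValue, List.take_append_of_le_length h',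
      List.drop_append_of_le_length h']
    refine bernoulliE_mono (fun z hz => hI (hA z (List.mem_of_mem_take hz))) fun c _ => ?_
    have := hVs (List.replicate (n + 1 - c) p ++ C.reverse.map (tau p q))
      ((A.drop (n + 1)).reverse.map (tau p q) ++ List.replicate c q) (tau p q y) (tau p q x)
      (List.forall_mem_append.2 ⟨mem_of_mem_replicate hpI _, hτ hC⟩)
      (List.forall_mem_append.2 ⟨hτ fun z hz => hA z (List.mem_of_mem_drop hz),
        mem_of_mem_replicate hqI _⟩)
      (tau_mem hqp (hI hy)) (tau_mem hqp (hI hx)) (tau_anti hqp hyx)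
    simp only [nextList, List.reverse_append, List.reverse_cons, List.map_append, List.map_cons,
      List.append_assoc, List.cons_append, List.nil_append] at this ⊢
    gcongr

theorem IsRotationBounded.stepValue (hq : 0 ≤ q) (hqp : q ≤ p) (hp : p ≤ 1) (hβ : 0 ≤ β)
    (hR : ∀ A : List ℝ, A.length = n → (∀ z ∈ A, z ∈ Set.Icc q p) →
      (bernoulliE A fun c => r (c + 1) - r c) ∈ Set.Icc 0 Rb)
    (hM : 0 ≤ M) (hRb : 0 ≤ Rb) (hMb : Rb + β * M ≤ M)
    (hVa : IsMultiaffine V) (hVs : IsSwapMonotone p q V)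
    (hVr : IsRotationBounded p q M (n + 1) V) :
    IsRotationBounded p q M (n + 1) (stepValue p q β r (n + 1) V) := by
  have hI : Set.Icc q p ⊆ Set.Icc (0 : ℝ) 1 := Set.Icc_subset_Icc hq hp
  have hpI : p ∈ Set.Icc q p := ⟨hqp, le_rfl⟩
  have hqI : q ∈ Set.Icc q p := ⟨le_rfl, hqp⟩
  intro L a hL ha hlen
  obtain ⟨A, v, C, h, rfl⟩ : ∃ A v C, A.length = n ∧ L = A ++ v :: C := by
    refine ⟨L.take n, L[n], L.drop (n + 1), by simp; omega, ?_⟩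
    rw [List.getElem_cons_drop, List.take_append_drop]
  simp only [List.forall_mem_append, List.forall_mem_cons] at hL
  obtain ⟨hA, hv, hC⟩ := hL
  have hY : ∀ z ∈ C.reverse.map (tau p q), z ∈ Set.Icc q p := by
    intro z hz
    obtain ⟨w, hw, rfl⟩ := List.mem_map.1 hz
    exact tau_mem hqp (hI (hC w (List.mem_reverse.1 hw)))
  have hP (c : ℕ) := mem_of_mem_replicate hpI (n - c)
  have hP' (c : ℕ) : ∀ z ∈ List.replicate (n - c) p ++ [p], z ∈ Set.Icc q p :=
    List.forall_mem_append.2 ⟨hP c, by simpa using hqp⟩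
  have hQ (c : ℕ) := mem_of_mem_replicate hqI c
  have hQ' (c : ℕ) : ∀ z ∈ q :: List.replicate c q, z ∈ Set.Icc q p :=
    List.forall_mem_cons.2 ⟨hqI, hQ c⟩
  have left : Bandit.stepValue p q β r (n + 1) V (a :: (A ++ v :: C)) =
      bernoulliE (a :: A) fun c => r c + β * V (nextList p q (n + 1) ([] ++ v :: C) c) := by
    have := stepValue_append p q β r V (a :: A) (v :: C)
    simpa only [List.cons_append, List.length_cons, h, List.nil_append] using this
  have right : Bandit.stepValue p q β r (n + 1) V ((A ++ v :: C) ++ [a]) =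
      bernoulliE (v :: A) fun c => r c + β * V (nextList p q (n + 1) (C ++ a :: []) c) := by
    have := stepValue_append p q β r V (A ++ [v]) (C ++ [a])
    simp only [List.append_assoc, List.cons_append, List.nil_append, List.length_append,
      List.length_singleton, h] at this ⊢
    rw [this]
    exact bernoulliE_perm (List.perm_append_singleton v A) _
  rw [left, right, bernoulliE_step_expand hVa, bernoulliE_step_expand hVa]
  simp only [List.nil_append]
  have hR' := hR A h hA
  have bound {f g : ℕ → ℝ} {t : ℝ}
      (hfg : ∀ c ≤ n, |f c - g c - t * (r (c + 1) - r c)| ≤ β * M) :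
      |bernoulliE A f - bernoulliE A g - t * bernoulliE A fun c => r (c + 1) - r c| ≤ β * M := by
    rw [← bernoulliE_sub, ← bernoulliE_const_mul, ← bernoulliE_sub, abs_le]
    have hA' : ∀ z ∈ A, z ∈ Set.Icc (0 : ℝ) 1 := fun z hz => hI (hA z hz)
    constructor
    · rw [← bernoulliE_const A (-(β * M))]
      exact bernoulliE_mono hA' fun c hc => (abs_le.1 (hfg c (h ▸ hc))).1
    · rw [← bernoulliE_const A (β * M)]
      exact bernoulliE_mono hA' fun c hc => (abs_le.1 (hfg c (h ▸ hc))).2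
  have scale {b b' t u u' : ℝ} (ht : b - b' = t) (hu : |u - u'| ≤ M) :
      |b + β * u - (b' + β * u') - t| ≤ β * M := by
    rw [show b + β * u - (b' + β * u') - t = β * (u - u') by linear_combination ht, abs_mul,
      abs_of_nonneg hβ]
    exact mul_le_mul_of_nonneg_left hu hβ
  have h₁₁ := bound (t := 0)
    (f := fun c => r (c + 1) + β * V (nextList p q (n + 1) (1 :: C) (c + 1)))
    (g := fun c => r (c + 1) + β * V (nextList p q (n + 1) (C ++ [1]) (c + 1))) <| by
    intro c hc
    rw [nextList_succ_cons_one, nextList_succ_concat_one]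
    obtain ⟨h₁, h₂⟩ := move_bot_bounds hqp hVs hVr (hP c) hY (hQ' c) (by simp; omega)
    exact scale (by ring) (abs_le.2 ⟨by linarith, h₂⟩)
  have h₀₀ := bound (t := 0)
    (f := fun c => r c + β * V (nextList p q (n + 1) (0 :: C) c))
    (g := fun c => r c + β * V (nextList p q (n + 1) (C ++ [0]) c)) <| by
    intro c hc
    rw [nextList_cons_zero p q C hc, nextList_concat_zero p q C hc]
    obtain ⟨h₁, h₂⟩ := move_top_bounds hqp hVs hVr (hP' c) hY (hQ c) (by simp; omega)
    simp only [List.append_assoc, List.cons_append, List.nil_append] at h₁ h₂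
    refine scale (by ring) (abs_le.2 ⟨?_, ?_⟩) <;> linarith
  have h₁₀ := bound (t := 1)
    (f := fun c => r (c + 1) + β * V (nextList p q (n + 1) (0 :: C) (c + 1)))
    (g := fun c => r c + β * V (nextList p q (n + 1) (C ++ [1]) c)) <| by
    intro c hc
    rw [nextList_succ_cons_zero, nextList_concat_one p q C hc]
    obtain ⟨h₁, h₂⟩ := move_top_bounds hqp hVs hVr (hP c) hY (hQ' c) (by simp; omega)
    obtain ⟨h₃, h₄⟩ := move_bot_bounds hqp hVs hVr (hP' c) hY (hQ c) (by simp; omega)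
    simp only [List.append_assoc, List.cons_append, List.nil_append] at h₃ h₄
    refine scale (by ring) (abs_le.2 ⟨?_, ?_⟩) <;> linarith
  have h₀₁ := bound (t := -1)
    (f := fun c => r c + β * V (nextList p q (n + 1) (1 :: C) c))
    (g := fun c => r (c + 1) + β * V (nextList p q (n + 1) (C ++ [0]) (c + 1))) <| by
    intro c hc
    rw [nextList_cons_one p q C hc, nextList_succ_concat_zero]
    exact scale (by ring) (by simpa using hM)
  have ha' := hI ha
  have hv' := hI hv
  have w₁₁ : 0 ≤ a * v := mul_nonneg ha'.1 hv'.1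
  have w₁₀ : 0 ≤ a * (1 - v) := mul_nonneg ha'.1 (by linarith [hv'.2])
  have w₀₁ : 0 ≤ (1 - a) * v := mul_nonneg (by linarith [ha'.2]) hv'.1
  have w₀₀ : 0 ≤ (1 - a) * (1 - v) := mul_nonneg (by linarith [ha'.2]) (by linarith [hv'.2])
  have avg {d₁₁ d₁₀ d₀₁ d₀₀ : ℝ} (e₁₁ : |d₁₁| ≤ M) (e₁₀ : |d₁₀| ≤ M) (e₀₁ : |d₀₁| ≤ M)
      (e₀₀ : |d₀₀| ≤ M) :
      |a * v * d₁₁ + a * (1 - v) * d₁₀ + (1 - a) * v * d₀₁ + (1 - a) * (1 - v) * d₀₀| ≤ M := by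
    rw [abs_le] at *
    constructor <;> nlinarith
  have close {u u' t : ℝ} (h : |u - u' - t| ≤ β * M) (ht : |t| ≤ Rb) : |u - u'| ≤ M := by
    rw [abs_le] at *
    constructor <;> linarith
  have hE := abs_le.2 ⟨by linarith [hR'.1], hR'.2⟩
  exact le_of_eq_of_le (congrArg _ (by ring))
    (avg (close h₁₁ (by simpa using hRb)) (close h₁₀ (by simpa using hE))
      (close h₀₁ (by simpa using hE)) (close h₀₀ (by simpa using hRb)))

theorem isSwapMonotone_iterate_stepValue (hq : 0 ≤ q) (hqp : q ≤ p) (hp : p ≤ 1) (hβ : 0 ≤ β)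
    (hβ₁ : β < 1) (hRl : 0 ≤ Rl) (hRb : 0 ≤ Rb)
    (hR : ∀ A : List ℝ, A.length = n → (∀ z ∈ A, z ∈ Set.Icc q p) →
      (bernoulliE A fun c => r (c + 1) - r c) ∈ Set.Icc Rl Rb)
    (hcond : β * (Rl + Rb) ≤ Rl) (s : ℕ) :
    IsSwapMonotone p q ((stepValue p q β r (n + 1))^[s] fun _ => 0) := by
  have hβ' : 0 < 1 - β := by linarith
  have hM : 0 ≤ Rb / (1 - β) := by positivity
  have hMb : Rb + β * (Rb / (1 - β)) ≤ Rb / (1 - β) := by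
    apply le_of_eq; field_simp; ring
  have hMl : β * (Rb / (1 - β)) ≤ Rl := by
    rw [← mul_div_assoc, div_le_iff₀ hβ']; linarith
  suffices IsMultiaffine ((stepValue p q β r (n + 1))^[s] fun _ => 0) ∧
      IsSwapMonotone p q ((stepValue p q β r (n + 1))^[s] fun _ => 0) ∧
      IsRotationBounded p q (Rb / (1 - β)) (n + 1)
        ((stepValue p q β r (n + 1))^[s] fun _ => 0) from this.2.1
  induction s with
  | zero => exact ⟨fun _ _ _ => by simp, fun _ _ _ _ _ _ _ _ _ => le_rfl,
      fun _ _ _ _ _ => by simpa using hM⟩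
  | succ s ih =>
    obtain ⟨ha, hs, hr⟩ := ih
    rw [Function.iterate_succ_apply']
    exact ⟨ha.stepValue p q β r (n + 1),
      IsSwapMonotone.stepValue hq hqp hp hβ (fun A h h' => (hR A h h').1) hMl ha hs hr,
      IsRotationBounded.stepValue hq hqp hp hβ
        (fun A h h' => ⟨hRl.trans (hR A h h').1, (hR A h h').2⟩) hM hRb hMb ha hs hr⟩

end Step

theorem senseSet_eq_toFinset (N k : ℕ) :
    senseSet N k = ((List.finRange N).take k).toFinset := by
  ext i
  simp only [senseSet, Finset.mem_filter, Finset.mem_univ, true_and, List.mem_toFinset,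
    List.mem_take_iff_getElem]
  constructor
  · intro h
    exact ⟨i, by simp [h], by simp⟩
  · rintro ⟨j, hj, rfl⟩
    simp at hj ⊢
    omega

theorem sum_senseSet_eq_bernoulliE {N : ℕ} (k : ℕ) (ω : Fin N → ℝ) (f : ℕ → ℝ) :
    ∑ A ∈ (senseSet N k).powerset,
      (∏ i ∈ A, ω i) * (∏ i ∈ senseSet N k \ A, (1 - ω i)) * f A.card =
      bernoulliE ((List.ofFn ω).take k) f := by
  rw [senseSet_eq_toFinset, sum_powerset_eq_bernoulliE ω _ ((List.nodup_finRange N).take),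
    List.map_take, List.ofFn_eq_map]

theorem ofFn_nextNeg (p q : ℝ) {N k c : ℕ} (hk : k ≤ N) (hc : c ≤ k) (ω : Fin N → ℝ) :
    List.ofFn (nextNeg p q k ω c) = nextList p q k ((List.ofFn ω).drop k) c := by
  apply List.ext_getElem
  · simp [nextList]; omega
  · intro i h₁ h₂
    simp only [List.length_ofFn] at h₁
    simp only [List.getElem_ofFn, nextNeg, nextList, List.getElem_append, List.length_replicate,
      List.getElem_replicate, List.length_map, List.length_reverse, List.length_drop,
      List.length_ofFn, List.getElem_map, List.getElem_reverse, List.getElem_drop]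
    split_ifs <;> first | rfl | omega | skip
    congr 3
    omega

theorem Wneg_eq_iterate (p q β : ℝ) {N k : ℕ} (hk : k ≤ N) (m s : ℕ) (ω : Fin N → ℝ) :
    Wneg p q β N k m s ω =
      (stepValue p q β (fun c => ((min c m : ℕ) : ℝ)) k)^[s + 1] (fun _ => 0) (List.ofFn ω) := by
  induction s generalizing ω with
  | zero =>
    simp only [Wneg, expReward, Function.iterate_one, stepValue, mul_zero, add_zero, zero_add]
    exact sum_senseSet_eq_bernoulliE k ω fun c => ((min c m : ℕ) : ℝ)
  | succ s ih =>
    rw [Function.iterate_succ_apply', stepValue, bernoulliE_add, bernoulliE_const_mul,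
      ← sum_senseSet_eq_bernoulliE, ← sum_senseSet_eq_bernoulliE, Wneg, expReward]
    congr 2
    refine Finset.sum_congr rfl fun A hA => ?_
    have hc : A.card ≤ k := by
      refine (Finset.card_le_card (Finset.mem_powerset.1 hA)).trans ?_
      rw [senseSet_eq_toFinset]
      exact (List.toFinset_card_le _).trans (by simp)
    rw [ih, ofFn_nextNeg p q hk hc]

theorem bernoulliE_reward_increment_mem {p q : ℝ} (hq : 0 ≤ q) (hp : p ≤ 1) {A : List ℝ}
    (hA : ∀ z ∈ A, z ∈ Set.Icc q p) (m : ℕ) :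
    (bernoulliE A fun c => ((min (c + 1) m : ℕ) : ℝ) - ((min c m : ℕ) : ℝ)) ∈
      Set.Icc (0 : ℝ) 1 := by
  have hA' : ∀ z ∈ A, z ∈ Set.Icc (0 : ℝ) 1 := fun z hz => Set.Icc_subset_Icc hq hp (hA z hz)
  constructor
  · rw [← bernoulliE_const A 0]
    refine bernoulliE_mono hA' fun c _ => sub_nonneg.2 ?_
    exact_mod_cast (by omega : min c m ≤ min (c + 1) m)
  · rw [← bernoulliE_const A 1]
    refine bernoulliE_mono hA' fun c _ => sub_le_iff_le_add.2 ?_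
    exact_mod_cast (by omega : min (c + 1) m ≤ 1 + min c m)

theorem expReward_cons_sub {n : ℕ} (m : ℕ) (x : Fin n → ℝ) :
    expReward m Finset.univ (Fin.cons 1 x : Fin (n + 1) → ℝ) -
      expReward m Finset.univ (Fin.cons 0 x : Fin (n + 1) → ℝ) =
      bernoulliE (List.ofFn x) fun c => ((min (c + 1) m : ℕ) : ℝ) - ((min c m : ℕ) : ℝ) := by
  have h (a : ℝ) : expReward m Finset.univ (Fin.cons a x : Fin (n + 1) → ℝ) =
      bernoulliE (a :: List.ofFn x) fun c => ((min c m : ℕ) : ℝ) := by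
    have := sum_powerset_eq_bernoulliE (Fin.cons a x : Fin (n + 1) → ℝ) _
      (List.nodup_finRange (n + 1)) fun c => ((min c m : ℕ) : ℝ)
    rw [List.toFinset_finRange, ← List.ofFn_eq_map, List.ofFn_succ] at this
    simpa only [expReward, Fin.cons_zero, Fin.cons_succ] using this
  rw [h, h, bernoulliE_sub]
  simp only [bernoulliE]
  ring

section Increments

variable {p q : ℝ}

theorem RdiffSet_subset (hq : 0 ≤ q) (hp : p ≤ 1) (m n : ℕ) :
    RdiffSet q p m n ⊆ Set.Icc 0 1 := by
  rintro _ ⟨x, hx, rfl⟩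
  rw [expReward_cons_sub]
  exact bernoulliE_reward_increment_mem hq hp (by simpa [List.mem_ofFn] using hx) m

theorem bernoulliE_mem_RdiffSet (m : ℕ) {A : List ℝ} (hA : ∀ z ∈ A, z ∈ Set.Icc q p) :
    (bernoulliE A fun c => ((min (c + 1) m : ℕ) : ℝ) - ((min c m : ℕ) : ℝ)) ∈
      RdiffSet q p m A.length :=
  ⟨A.get, fun i => hA _ (List.get_mem A i), by rw [expReward_cons_sub, List.ofFn_get]⟩

end Increments

theorem ofFn_swapAt {N : ℕ} (ω : Fin N → ℝ) {j : ℕ} (hj : j + 1 < N) (x y : ℝ) :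
    List.ofFn (swapAt ω j x y) =
      (List.ofFn ω).take j ++ x :: y :: (List.ofFn ω).drop (j + 2) := by
  apply List.ext_getElem
  · simp; omega
  · intro i h₁ h₂
    simp only [List.length_ofFn] at h₁
    rw [List.getElem_ofFn, List.getElem_append]
    simp only [swapAt, List.length_take, List.length_ofFn, List.getElem_take, List.getElem_ofFn,
      min_eq_left (by omega : j ≤ N)]
    split_ifs with h₃ h₄ h₅ h₆ h₇
    · omega
    · simp [h₃]
    · omega
    · simp [h₅]
    · rfl
    · obtain ⟨d, rfl⟩ : ∃ d, i = j + (d + 2) := ⟨i - j - 2, by omega⟩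
      simp only [Nat.add_sub_cancel_left, List.getElem_cons_succ, List.getElem_drop,
        List.getElem_ofFn]
      congr 2
      omega

end Bandit

/-- key inequality L5 (adjacent-swap inequality) for negatively
correlated channels. -/
theorem Wneg_L5 (p01 p11 β : ℝ) (h0 : p01 ∈ Set.Icc (0 : ℝ) 1)
    (h1 : p11 ∈ Set.Icc (0 : ℝ) 1) (hp : p11 ≤ p01)
    (N k m T : ℕ) (hm : 1 ≤ m) (hmk : m ≤ k) (hkN : k ≤ N) (hT : 1 ≤ T)
    (hβ0 : 0 ≤ β) (hβ1 : β < 1)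
    (hcond : β * (Rlow p11 p01 m (k - 1) + Rbar p11 p01 m (k - 1)) ≤
      Rlow p11 p01 m (k - 1)) :
    ∀ t, 1 ≤ t → t ≤ T → ∀ j : ℕ, 1 ≤ j → j ≤ N - 1 → ∀ ω : Fin N → ℝ,
      (∀ i, ω i ∈ Set.Icc p11 p01) → Antitone ω →
      ∀ x y : ℝ, x ∈ Set.Icc p11 p01 → y ∈ Set.Icc p11 p01 → y ≤ x →
      Wneg p01 p11 β N k m (T - t) (swapAt ω (j - 1) x y) ≥
        Wneg p01 p11 β N k m (T - t) (swapAt ω (j - 1) y x) := by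
  intro t _ _ j hj₁ hjN ω hω _ x y hx hy hyx
  obtain ⟨n, rfl⟩ : ∃ n, k = n + 1 := ⟨k - 1, by omega⟩
  have hsub := Bandit.RdiffSet_subset h1.1 h0.2 m n
  have hab : BddAbove (RdiffSet p11 p01 m n) := bddAbove_Icc.mono hsub
  have hbe : BddBelow (RdiffSet p11 p01 m n) := bddBelow_Icc.mono hsub
  have hmono := Bandit.isSwapMonotone_iterate_stepValue (r := fun c => ((min c m : ℕ) : ℝ))
    h1.1 hp h0.2 hβ0 hβ1
    (Real.sInf_nonneg fun _ h => (hsub h).1) (Real.sSup_nonneg fun _ h => (hsub h).1)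
    (fun A hA hA' => by
      have h := Bandit.bernoulliE_mem_RdiffSet m hA'
      rw [hA] at h
      exact ⟨csInf_le hbe h, le_csSup hab h⟩) hcond (T - t + 1)
  rw [ge_iff_le, Bandit.Wneg_eq_iterate _ _ _ hkN, Bandit.Wneg_eq_iterate _ _ _ hkN,
    Bandit.ofFn_swapAt ω (by omega), Bandit.ofFn_swapAt ω (by omega)]
  have hL : ∀ z ∈ List.ofFn ω, z ∈ Set.Icc p11 p01 := by
    intro z hz
    obtain ⟨i, rfl⟩ := List.mem_ofFn.1 hz
    exact hω i
  exact hmono _ _ x y (fun z hz => hL z (List.mem_of_mem_take hz))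
    (fun z hz => hL z (List.mem_of_mem_drop hz)) hx hy hyx
end
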